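/- arXiv:0905.0243 — 5 statements merged into one kernel-verified Lean document; each statement's English description precedes it below -/
import Mathlib

section
/- Let α be a multi-index with dual α* = (α*_1,…,α*_t). Then the Newton series F_α(z) converges for every z ∈ ℂ with Re z > −α*_1 and diverges for every z ∈ ℂ ∖ ℕ with Re z < −α*_1; that is, the abscissa of convergence of F_α equals −α*_1. -/
open scoped BigOperators

/-- A multi-index: a nonempty finite sequence of positive integers. -/
def MIdx (α : List ℕ) : Prop := α ≠ [] ∧ ∀ a ∈ α, 1 ≤ a

/-- The set `S_m(α) = {α₁, α₁+α₂, …, α₁+⋯+α_{s-1}} ⊆ {1,…,m-1}` of proper partial sums. -/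
def boundarySet (α : List ℕ) : Finset ℕ :=
  (((List.scanl (· + ·) 0 α).drop 1).dropLast).toFinset

def diffAux : ℕ → List ℕ → List ℕ
  | _, [] => []
  | p, a :: t => (a - p) :: diffAux a t

/-- The dual multi-index `α*`. -/
def dualIdx (α : List ℕ) : List ℕ :=
  diffAux 0 ((insert α.sum (Finset.Icc 1 (α.sum - 1) \ boundarySet α)).sort (· ≤ ·))

/-- The finite multiple harmonic sum
`S_α(n) = Σ_{n > n₁ ≥ ⋯ ≥ n_s ≥ 0} 1/((n₁+1)^{α₁} ⋯ (n_s+1)^{α_s})`. -/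
noncomputable def hsum : List ℕ → ℕ → ℝ
  | [], _ => 1
  | a :: t, n => ∑ m ∈ Finset.range n, (1 / ((m : ℝ) + 1) ^ a) * hsum t (m + 1)

open Classical in
/-- The summand of the multiple series `G_α(z)`, indexed by tuples
`v : Fin |α| → ℕ`; it vanishes unless all `v j` are positive and the chain of
comparisons dictated by `α` holds (strict within blocks, weak between blocks). -/
noncomputable def Gterm (α : List ℕ) (z : ℂ) (v : Fin α.sum → ℕ) : ℂ :=
  if (∀ j, 0 < v j) ∧ (∀ j k : Fin α.sum, (k : ℕ) = (j : ℕ) + 1 →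
        (if (k : ℕ) ∈ boundarySet α then v k ≤ v j else v k < v j))
  then ∏ j : Fin α.sum, (if (j : ℕ) = 0 then (1 / (v j : ℂ) - 1 / ((v j : ℂ) + z))
             else if (j : ℕ) ∈ boundarySet α then 1 / ((v j : ℂ) + z)
             else 1 / (v j : ℂ))
  else 0

/-- The multiple series `G_α(z)`. -/
noncomputable def Gfun (α : List ℕ) (z : ℂ) : ℂ := ∑' v : Fin α.sum → ℕ, Gterm α z v

/-- `⁻α` : remove 1 from the first entry. -/
def lminus (α : List ℕ) : List ℕ :=
  match α with
  | [] => []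
  | a :: t => if 2 ≤ a then (a - 1) :: t else t

/-- `α⁻` : remove 1 from the last entry. -/
def rminus (α : List ℕ) : List ℕ :=
  if 2 ≤ α.getLastD 0 then α.dropLast ++ [α.getLastD 0 - 1] else α.dropLast

/-- The difference operator `(Δa)(n) = a(n) - a(n+1)`. -/
def delOp (a : ℕ → ℂ) : ℕ → ℂ := fun n => a n - a (n + 1)

/-- The inversion operator `(∇a)(n) = (Δⁿa)(0)`. -/
def nablaOp (a : ℕ → ℂ) : ℕ → ℂ := fun n => delOp^[n] a 0

/-- The generalized binomial coefficient `z(z-1)⋯(z-n+1)/n!`. -/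
noncomputable def cbinom (z : ℂ) (n : ℕ) : ℂ :=
  (∏ i ∈ Finset.range n, (z - (i : ℂ))) / (n.factorial : ℂ)

/-- The Newton series with coefficients `c` converges at `z` to `L`. -/
def NewtonSeriesTo (c : ℕ → ℂ) (z L : ℂ) : Prop :=
  Filter.Tendsto (fun N => ∑ n ∈ Finset.range N, (-1 : ℂ) ^ n * c n * cbinom z n)
    Filter.atTop (nhds L)

/-- The Newton series interpolating the sequence `a` converges at `z` to `L`. -/
def NewtonSumsTo (a : ℕ → ℂ) (z L : ℂ) : Prop := NewtonSeriesTo (nablaOp a) z L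

open Classical in
/-- `ζ_α(μ)` : the nested sum over tuples patterned on `α` with exponents `μ`. -/
noncomputable def zetaIdx (α : List ℕ) (μ : List ℕ) : ℝ :=
  ∑' v : Fin α.sum → ℕ,
    if (∀ j, 0 < v j) ∧ (∀ j k : Fin α.sum, (k : ℕ) = (j : ℕ) + 1 →
          (if (k : ℕ) ∈ boundarySet α then v k ≤ v j else v k < v j))
    then ∏ j : Fin α.sum, (1 : ℝ) / (v j : ℝ) ^ (μ.getD (j : ℕ) 1)
    else 0

/-- The multiple zeta value `ζ(μ) = ζ_{(p)}(μ)`. -/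
noncomputable def MZV (μ : List ℕ) : ℝ := zetaIdx [μ.length] μ

/-- `⁺μ` : add 1 to the first entry. -/
def mplus : List ℕ → List ℕ
  | [] => []
  | a :: t => (a + 1) :: t

/-- `ζ` extended ℚ-linearly to the vector space with basis the multi-indices. -/
noncomputable def zetaLin (v : List ℕ →₀ ℚ) : ℝ := v.sum fun μ c => (c : ℝ) * MZV μ

/-- `ζ⁺(μ) = ζ(⁺μ)`, extended ℚ-linearly. -/
noncomputable def zetaPlusLin (v : List ℕ →₀ ℚ) : ℝ := v.sum fun μ c => (c : ℝ) * MZV (mplus μ)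

/-- All ways of splitting a list into consecutive nonempty blocks. -/
def splits : List ℕ → List (List (List ℕ))
  | [] => [[]]
  | a :: t =>
      (splits t).map (fun c => [a] :: c) ++
      (splits t).filterMap (fun c =>
        match c with
        | [] => none
        | b :: r => some ((a :: b) :: r))

/-- `d(α) = Σ_{β ≤ α} β`, the sum over all coarsenings of `α`. -/
noncomputable def dmap (α : List ℕ) : List ℕ →₀ ℚ :=
  ((splits α).map fun c => Finsupp.single (c.map List.sum) (1 : ℚ)).sum

/-- All compositions of `n` into positive parts. -/
def comps : ℕ → List (List ℕ)
  | 0 => [[]]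
  | n + 1 => (List.range (n + 1)).flatMap fun j => (comps (n - j)).map fun c => (j + 1) :: c

/-- All refinements of `α`. -/
def refts : List ℕ → List (List ℕ)
  | [] => [[]]
  | a :: t => (comps a).flatMap fun c => (refts t).map fun β => c ++ β

/-- `u(α) = Σ_{β ≥ α} β`, the sum over all refinements of `α`. -/
noncomputable def umap (α : List ℕ) : List ℕ →₀ ℚ :=
  ((refts α).map fun β => Finsupp.single β (1 : ℚ)).sum

/-- The harmonic (quasi-shuffle) product on multi-indices, with values in the
ℚ-vector space with basis the multi-indices. -/
noncomputable def hprod : List ℕ → List ℕ → (List ℕ →₀ ℚ)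
  | [], u => Finsupp.single u 1
  | a :: s, [] => Finsupp.single (a :: s) 1
  | a :: s, b :: t =>
      Finsupp.mapDomain (List.cons a) (hprod s (b :: t)) +
      Finsupp.mapDomain (List.cons b) (hprod (a :: s) t) +
      Finsupp.mapDomain (List.cons (a + b)) (hprod s t)
  termination_by l₁ l₂ => l₁.length + l₂.length

/-- `α ⊛ β = (α₁+β₁) # (⁻α ∗ ⁻β)`. -/
noncomputable def circAst : List ℕ → List ℕ → (List ℕ →₀ ℚ)
  | a :: s, b :: t =>
      Finsupp.mapDomain (List.cons (a + b)) (hprod (lminus (a :: s)) (lminus (b :: t)))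
  | _, _ => 0

/-- `⊛` extended linearly in the first argument. -/
noncomputable def circAstLin (v : List ℕ →₀ ℚ) (β : List ℕ) : List ℕ →₀ ℚ :=
  v.sum fun γ c => c • circAst γ β

/-- The exponent list `(k₁+1,1,…,1, k₂+1,1,…,1, …, k_s+1,1,…,1)`, the `i`-th block
having length `α_i`. -/
def blockList (α : List ℕ) (ks : Fin α.length → ℕ) : List ℕ :=
  (List.ofFn fun i => (ks i + 1) :: List.replicate (α.get i - 1) 1).flatten

/-- `Q_r(n₁,…,n_r; z) = 1/((n₁+z)⋯(n_r+z))`, with `Q_0 = 1`. -/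
noncomputable def Qprod (l : List ℕ) (z : ℂ) : ℂ := (l.map fun n => 1 / ((n : ℂ) + z)).prod

/-- `R_r(n₁,…,n_r) = 1/(n₁⋯n_r)`, with `R_0 = 1`. -/
noncomputable def Rprod (l : List ℕ) : ℂ := (l.map fun n => 1 / (n : ℂ)).prod

/-- A block of `len` variables of factor type `fTy` (1 = Q-type, 2 = R-type); the first
carries the comparison `joinWeak` to the previous variable, subsequent ones carry the
block-internal comparison (weak inside Q-blocks, strict inside R-blocks). -/
def blockPart (fTy : ℕ) (joinWeak : Bool) : ℕ → List (ℕ × Bool)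
  | 0 => []
  | m + 1 => (fTy, joinWeak) :: List.replicate m (fTy, fTy == 1)

/-- The word of (factor type, comparison) pairs describing a `Φ`-sum: `qr` is the
weakness of the `□'` joins (Q-block to R-block) and `rq` that of the `□` joins
(R-block to next Q-block). -/
def mkWord (qr rq : Bool) (gs : List (ℕ × ℕ)) : List (ℕ × Bool) :=
  gs.flatMap fun g => blockPart 1 rq g.1 ++ blockPart 2 qr g.2

/-- The word of a `Φ`-sum: the very first factor is of `Q̃`-type (coded 0). -/
def phiWord (qr rq : Bool) (gs : List (ℕ × ℕ)) : List (ℕ × Bool) :=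
  match mkWord qr rq gs with
  | [] => []
  | (_, b) :: t => (0, b) :: t

open Classical in
/-- The nested sum `Φ_z` attached to a word `w` of (factor type, comparison) pairs:
factor type 0 gives `1/n - 1/(n+z)`, type 1 gives `1/(n+z)`, type 2 gives `1/n`;
comparison `true` means `≥`, `false` means `>`. -/
noncomputable def PhiSum (w : List (ℕ × Bool)) (z : ℂ) : ℂ :=
  ∑' v : Fin w.length → ℕ,
    if (∀ j, 0 < v j) ∧ (∀ j k : Fin w.length, (k : ℕ) = (j : ℕ) + 1 →
          (if (w.get k).2 then v k ≤ v j else v k < v j))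
    then ∏ j : Fin w.length, (if (w.get j).1 = 0 then (1 / (v j : ℂ) - 1 / ((v j : ℂ) + z))
               else if (w.get j).1 = 1 then 1 / ((v j : ℂ) + z)
               else 1 / (v j : ℂ))
    else 0

/-! ### The inversion formula -/

/-- `s_α(n) = S_α(n+1) - S_α(n)`. -/
noncomputable def scH : List ℕ → ℕ → ℝ
  | [], _ => 1
  | a :: t, n => (1 / ((n : ℝ) + 1) ^ a) * hsum t (n + 1)

lemma delOp_iter_succ (a : ℕ → ℂ) (k n : ℕ) :
    delOp^[k + 1] a n = delOp^[k] a n - delOp^[k] a (n + 1) := by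
  rw [Function.iterate_succ_apply']; rfl

/-- `∇ A a = A Σ ∇ a`. -/
lemma delOp_iter_mul (a b : ℕ → ℂ) (h : ∀ n, a n = ((n : ℂ) + 1) * b n) (k : ℕ) : ∀ n,
    delOp^[k + 1] a n = ((n : ℂ) + 1 + (k + 1)) * delOp^[k + 1] b n
      - (k + 1) * delOp^[k] b n := by
  induction k with
  | zero =>
    intro n
    rw [delOp_iter_succ, delOp_iter_succ]
    simp only [Function.iterate_zero, id_eq, h]
    push_cast; ring
  | succ k ih =>
    intro n
    rw [delOp_iter_succ, ih, ih, delOp_iter_succ b (k + 1) n, delOp_iter_succ b k n,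
      delOp_iter_succ b k (n + 1)]
    push_cast; ring

lemma nabla_A (a b : ℕ → ℂ) (h : ∀ n, a n = ((n : ℂ) + 1) * b n) (n : ℕ) :
    ((n : ℂ) + 1) * nablaOp b n = ∑ k ∈ Finset.range (n + 1), nablaOp a k := by
  induction n with
  | zero => simp [nablaOp, h]
  | succ n ih =>
    rw [Finset.sum_range_succ, ← ih]
    have := delOp_iter_mul a b h n 0
    simp only [nablaOp] at *
    rw [this]; push_cast; ring

/-- auxiliary for `∇ A Σ = A ∇`. -/
lemma delOp_iter_mul' (c b b' : ℕ → ℂ) (h : ∀ n, c n = (n : ℂ) * b' n)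
    (hb : ∀ n, b' (n + 1) = b n) (k : ℕ) : ∀ n,
    delOp^[k + 1] c n = (n : ℂ) * delOp^[k + 1] b' n - (k + 1) * delOp^[k] b n := by
  have hs : ∀ k n, delOp^[k] b' (n + 1) = delOp^[k] b n := by
    intro k
    induction k with
    | zero => intro n; simp [hb]
    | succ k ih => intro n; rw [delOp_iter_succ, delOp_iter_succ, ih, ih]
  induction k with
  | zero =>
    intro n
    rw [delOp_iter_succ, delOp_iter_succ]
    simp only [Function.iterate_zero, id_eq, h, ← hb]
    push_cast; ring
  | succ k ih =>
    intro n
    rw [delOp_iter_succ, ih, ih, delOp_iter_succ b' (k + 1) n, delOp_iter_succ b k n,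
      ← hs k n, ← hs k (n + 1), delOp_iter_succ b' k (n + 1)]
    push_cast; ring

lemma nabla_AS (a b : ℕ → ℂ)
    (h : ∀ n : ℕ, ((n : ℂ) + 1) * b n = ∑ k ∈ Finset.range (n + 1), a k) (n : ℕ) :
    nablaOp a n = ((n : ℂ) + 1) * nablaOp b n := by
  set c : ℕ → ℂ := fun n => ∑ k ∈ Finset.range n, a k with hc
  set b' : ℕ → ℂ := fun n => b (n - 1) with hb'
  have h1 : ∀ n, c n = (n : ℂ) * b' n := by
    intro n
    cases n with
    | zero => simp [hc]
    | succ n => simp [hc, hb', ← h]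
  have h2 := delOp_iter_mul' c b b' h1 (fun n => by simp [hb']) n 0
  have h3 : delOp c = fun n => (-1 : ℂ) * a n := by
    funext n; simp [delOp, hc, Finset.sum_range_succ]
  have h4 : ∀ k n, delOp^[k] (fun n => (-1 : ℂ) * a n) n = - delOp^[k] a n := by
    intro k
    induction k with
    | zero => intro n; simp
    | succ k ih => intro n; rw [delOp_iter_succ, delOp_iter_succ, ih, ih]; ring
  rw [Function.iterate_succ_apply, h3, h4] at h2
  simp only [nablaOp]
  simp at h2
  exact h2

/-! ### Boundary sets -/

lemma boundarySet_single (a : ℕ) : boundarySet [a] = ∅ := by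
  simp [boundarySet]

lemma scanl_shift (a c : ℕ) (l : List ℕ) :
    List.scanl (· + ·) (a + c) l = (List.scanl (· + ·) c l).map (a + ·) := by
  induction l generalizing c with
  | nil => simp
  | cons b l ih => simp [add_assoc, ih]

lemma boundarySet_cons (a b : ℕ) (t : List ℕ) :
    boundarySet (a :: b :: t) = insert a ((boundarySet (b :: t)).image (a + ·)) := by
  have h := scanl_shift a 0 (b :: t)
  ext x
  simp only [boundarySet, List.scanl_cons, List.drop_succ_cons, List.drop_zero] at h ⊢
  have h' := scanl_shift a b t
  simp only [zero_add] at h' ⊢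
  rw [h', List.dropLast_cons_of_ne_nil (by simp)]
  simp only [List.mem_toFinset, List.mem_cons, Finset.mem_insert, Finset.mem_image,
    ← List.map_dropLast, List.mem_map]

/-- `h` is the least positive integer outside the boundary set. -/
def IsHd (α : List ℕ) (h : ℕ) : Prop :=
  1 ≤ h ∧ h ∉ boundarySet α ∧ h ≤ α.sum ∧ ∀ j, 1 ≤ j → j < h → j ∈ boundarySet α

lemma boundarySet_ge (a x : ℕ) (t : List ℕ) (hx : x ∈ boundarySet (a :: t)) : a ≤ x := by
  cases t with
  | nil => simp [boundarySet_single] at hx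
  | cons b t =>
    rw [boundarySet_cons] at hx
    simp at hx
    omega

lemma isHd_two (a : ℕ) (t : List ℕ) : IsHd ((a + 2) :: t) 1 := by
  refine ⟨le_refl _, ?_, by simp; omega, by intros; omega⟩
  intro h
  have := boundarySet_ge _ _ _ h
  omega

lemma isHd_one : IsHd [1] 1 := by
  refine ⟨le_refl _, by simp [boundarySet_single], by simp, by intros; omega⟩

lemma isHd_cons (b : ℕ) (t : List ℕ) (h : ℕ) (H : IsHd (b :: t) h) :
    IsHd (1 :: b :: t) (h + 1) := by
  obtain ⟨h1, h2, h3, h4⟩ := H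
  refine ⟨by omega, ?_, ?_, ?_⟩
  · rw [boundarySet_cons]
    simp only [Finset.mem_insert, Finset.mem_image, not_or, not_exists, not_and]
    refine ⟨by omega, ?_⟩
    intro x hx hxh
    have : x = h := by omega
    exact h2 (this ▸ hx)
  · rw [List.sum_cons]; omega
  · intro j hj hjh
    rw [boundarySet_cons]
    simp only [Finset.mem_insert, Finset.mem_image]
    by_cases hj1 : j = 1
    · exact Or.inl hj1
    · exact Or.inr ⟨j - 1, h4 _ (by omega) (by omega), by omega⟩

lemma dual_head (α : List ℕ) (h : ℕ) (H : IsHd α h) : (dualIdx α).headI = h := by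
  obtain ⟨h1, h2, h3, h4⟩ := H
  unfold dualIdx
  set s := insert α.sum (Finset.Icc 1 (α.sum - 1) \ boundarySet α) with hs
  have hmem : h ∈ s := by
    simp only [hs, Finset.mem_insert, Finset.mem_sdiff, Finset.mem_Icc]
    by_cases hh : h = α.sum
    · exact Or.inl hh
    · exact Or.inr ⟨⟨h1, by omega⟩, h2⟩
  have hle : ∀ x ∈ s, h ≤ x := by
    intro x hx
    simp only [hs, Finset.mem_insert, Finset.mem_sdiff, Finset.mem_Icc] at hx
    rcases hx with rfl | ⟨⟨hx1, _⟩, hx2⟩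
    · exact h3
    · by_contra hlt
      exact hx2 (h4 x hx1 (by omega))
  have hsorted := s.pairwise_sort (· ≤ ·)
  have hm : ∀ x, x ∈ s.sort (· ≤ ·) ↔ x ∈ s := fun x => Finset.mem_sort _
  generalize s.sort (· ≤ ·) = l at hsorted hm
  cases l with
  | nil => exact absurd ((hm h).2 hmem) (by simp)
  | cons b l =>
    simp only [diffAux, List.headI, Nat.sub_zero]
    apply le_antisymm
    · have := (hm h).2 hmem
      rw [List.mem_cons] at this
      rcases this with rfl | hl
      · exact le_refl _
      · exact (List.pairwise_cons.1 hsorted).1 _ hl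
    · exact hle b ((hm b).1 (by simp))

/-! ### Bounds for the Newton coefficients -/

lemma sc_one (b n : ℕ) (t : List ℕ) :
    ((n : ℝ) + 1) * scH (1 :: b :: t) n = ∑ k ∈ Finset.range (n + 1), scH (b :: t) k := by
  have : (n : ℝ) + 1 ≠ 0 := by positivity
  simp only [scH, hsum]
  field_simp

lemma sc_two (a n : ℕ) (t : List ℕ) :
    scH ((a + 1) :: t) n = ((n : ℝ) + 1) * scH ((a + 2) :: t) n := by
  have : (n : ℝ) + 1 ≠ 0 := by positivity
  simp only [scH]
  field_simp
  ring

/-- The real harmonic numbers. -/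
noncomputable def Hr (n : ℕ) : ℝ := ∑ i ∈ Finset.range n, 1 / ((i : ℝ) + 1)

lemma Hr_mono : Monotone Hr := by
  apply monotone_nat_of_le_succ
  intro n
  unfold Hr
  rw [Finset.sum_range_succ]
  have : 0 ≤ 1 / ((n : ℝ) + 1) := by positivity
  linarith

lemma Hr_one (n : ℕ) : 1 ≤ Hr (n + 1) := by
  have := Hr_mono (show 1 ≤ n + 1 by omega)
  simpa [Hr] using this

/-- The package of facts about `∇ s_α`. -/
def Good (α : List ℕ) : Prop :=
  ∃ (D : ℕ → ℝ) (k h : ℕ), IsHd α h ∧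
    (∀ n, nablaOp (fun n => (scH α n : ℂ)) n = (D n : ℂ)) ∧
    (∀ n : ℕ, 1 / ((n : ℝ) + 1) ^ h ≤ D n) ∧
    (∀ n : ℕ, D n ≤ Hr (n + 1) ^ k / ((n : ℝ) + 1) ^ h)

lemma good_AS (D : ℕ → ℝ) (k h : ℕ) (hh : 1 ≤ h) (hl : ∀ n : ℕ, 1 / ((n : ℝ) + 1) ^ h ≤ D n)
    (hu : ∀ n : ℕ, D n ≤ Hr (n + 1) ^ k / ((n : ℝ) + 1) ^ h) (n : ℕ) :
    1 ≤ ∑ j ∈ Finset.range (n + 1), D j ∧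
    ∑ j ∈ Finset.range (n + 1), D j ≤ Hr (n + 1) ^ (k + 1) := by
  constructor
  · have h0 : 1 ≤ D 0 := by simpa using hl 0
    have : D 0 ≤ ∑ j ∈ Finset.range (n + 1), D j :=
      Finset.single_le_sum (f := D) (fun i _ => le_trans (by positivity) (hl i)) (by simp)
    linarith
  · rw [pow_succ]
    conv_rhs => rw [Hr, ← Hr]
    rw [show Hr (n + 1) ^ k * Hr (n + 1) =
      ∑ j ∈ Finset.range (n + 1), Hr (n + 1) ^ k * (1 / ((j : ℝ) + 1)) by
        rw [← Finset.mul_sum]; rfl]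
    apply Finset.sum_le_sum
    intro j hj
    have hj' : j + 1 ≤ n + 1 := by simpa using hj
    refine (hu j).trans ?_
    rw [div_eq_mul_one_div]
    have hj1 : (1 : ℝ) ≤ (j : ℝ) + 1 := by have : (0 : ℝ) ≤ j := by positivity
                                           linarith
    have h1 : (j : ℝ) + 1 ≤ ((j : ℝ) + 1) ^ h := le_self_pow₀ hj1 (by omega)
    have h2 : Hr (j + 1) ≤ Hr (n + 1) := Hr_mono hj'
    have h3 := Hr_one j
    have h4 := Hr_one n
    gcongr

lemma good_step_two (a : ℕ) (t : List ℕ) (H : Good ((a + 1) :: t)) : Good ((a + 2) :: t) := by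
  obtain ⟨D, k, h, hh, hD, hl, hu⟩ := H
  have hb := good_AS D k h hh.1 hl hu
  refine ⟨fun n => (∑ j ∈ Finset.range (n + 1), D j) / ((n : ℝ) + 1), k + 1, 1,
    isHd_two a t, ?_, ?_, ?_⟩
  · intro n
    have h1 := nabla_A (fun n => (scH ((a + 1) :: t) n : ℂ)) (fun n => (scH ((a + 2) :: t) n : ℂ))
      (fun n => by rw [sc_two]; push_cast; ring) n
    have : (n : ℂ) + 1 ≠ 0 := Nat.cast_add_one_ne_zero n
    simp only [hD] at h1
    push_cast
    rw [eq_div_iff this, ← h1]; ring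
  · intro n
    have := (hb n).1
    rw [pow_one]
    exact div_le_div_of_nonneg_right this (by positivity)
  · intro n
    have := (hb n).2
    rw [pow_one]
    exact div_le_div_of_nonneg_right this (by positivity)

lemma good_single : Good [1] := by
  refine ⟨fun n => 1 / ((n : ℝ) + 1), 0, 1, isHd_one, ?_, by simp, by simp⟩
  intro n
  have h1 := nabla_A (fun _ => 1) (fun n => (scH [1] n : ℂ))
      (fun n => by
        have : (n : ℂ) + 1 ≠ 0 := Nat.cast_add_one_ne_zero n
        simp [scH, hsum]; field_simp) n
  have h2 : ∀ k, nablaOp (fun _ => 1) (k + 1) = 0 := by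
    intro k
    have : delOp (fun _ => 1) = fun _ => 0 := by funext n; simp [delOp]
    simp only [nablaOp, Function.iterate_succ_apply, this]
    have h0 : ∀ k n, delOp^[k] (fun _ => 0) n = 0 := by
      intro k
      induction k with
      | zero => intro n; simp
      | succ k ih => intro n; rw [delOp_iter_succ, ih, ih]; ring
    exact h0 k 0
  rw [Finset.sum_range_succ'] at h1
  simp only [h2, Finset.sum_const_zero, zero_add] at h1
  have : (n : ℂ) + 1 ≠ 0 := Nat.cast_add_one_ne_zero n
  push_cast
  rw [eq_div_iff this, mul_comm, h1]
  simp [nablaOp]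

lemma good_cons (b : ℕ) (t : List ℕ) (H : Good (b :: t)) : Good (1 :: b :: t) := by
  obtain ⟨D, k, h, hh, hD, hl, hu⟩ := H
  refine ⟨fun n => D n / ((n : ℝ) + 1), k, h + 1, isHd_cons b t h hh, ?_, ?_, ?_⟩
  · intro n
    have h1 := nabla_AS (fun n => (scH (b :: t) n : ℂ)) (fun n => (scH (1 :: b :: t) n : ℂ))
      (fun n => by exact_mod_cast sc_one b n t) n
    have : (n : ℂ) + 1 ≠ 0 := Nat.cast_add_one_ne_zero n
    push_cast
    rw [← hD, h1]
    field_simp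
  · intro n
    rw [pow_succ, ← div_div]
    have := hl n
    exact div_le_div_of_nonneg_right this (by positivity)
  · intro n
    rw [pow_succ, ← div_div]
    have := hu n
    exact div_le_div_of_nonneg_right this (by positivity)

lemma good_all (α : List ℕ) (hα : α ≠ []) (hp : ∀ a ∈ α, 1 ≤ a) : Good α := by
  induction α with
  | nil => exact absurd rfl hα
  | cons a t ih =>
    have h1 : Good (1 :: t) := by
      cases t with
      | nil => exact good_single
      | cons b t =>
        exact good_cons b t (ih (by simp) (fun a ha => hp a (List.mem_cons_of_mem _ ha)))
    have h2 : ∀ m, Good ((m + 1) :: t) := by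
      intro m
      induction m with
      | zero => exact h1
      | succ m ihm => exact good_step_two m t ihm
    obtain ⟨m, rfl⟩ : ∃ m, a = m + 1 := ⟨a - 1, by have := hp a (by simp); omega⟩
    exact h2 m

/-- Everything needed about the Newton coefficients of `S_α`. -/
lemma newton_coeffs (α : List ℕ) (hα : MIdx α) :
    ∃ (e : ℕ → ℝ) (k : ℕ), (∀ n, nablaOp (fun n => (hsum α n : ℂ)) n = -(e n : ℂ)) ∧
      (∀ n, 0 ≤ e n) ∧
      (∀ n, 1 / ((n + 1 : ℕ) : ℝ) ^ (dualIdx α).headI ≤ e (n + 1)) ∧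
      (∀ n, e (n + 1) ≤ Hr (n + 1) ^ k / ((n + 1 : ℕ) : ℝ) ^ (dualIdx α).headI) := by
  obtain ⟨D, k, h, hh, hD, hl, hu⟩ := good_all α hα.1 hα.2
  rw [dual_head α h hh]
  refine ⟨fun n => if n = 0 then 0 else D (n - 1), k, ?_, ?_, ?_, ?_⟩
  · intro n
    obtain ⟨a, t, rfl⟩ := List.exists_cons_of_ne_nil hα.1
    cases n with
    | zero => simp [nablaOp, hsum]
    | succ n =>
      have h3 : delOp (fun n => (hsum (a :: t) n : ℂ)) =
          fun n => (-1 : ℂ) * (scH (a :: t) n : ℂ) := by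
        funext n; simp [delOp, hsum, scH, Finset.sum_range_succ]
      have h4 : ∀ (a : ℕ → ℂ) k n, delOp^[k] (fun n => (-1 : ℂ) * a n) n = - delOp^[k] a n := by
        intro a k
        induction k with
        | zero => intro n; simp
        | succ k ih => intro n; rw [delOp_iter_succ, delOp_iter_succ, ih, ih]; ring
      have := hD n
      simp only [nablaOp] at this ⊢
      rw [Function.iterate_succ_apply, h3, h4, this]
      simp
  · intro n
    dsimp only
    split_ifs
    · exact le_refl _
    · exact le_trans (by positivity) (hl (n - 1))
  · intro n; simpa using hl n
  · intro n; simpa using hu n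

/-! ### Asymptotics -/

open Filter Topology Asymptotics in
lemma cbinom_tendsto (z : ℂ) (hz : ∀ n : ℕ, z ≠ (n : ℂ)) :
    Tendsto (fun n : ℕ => ‖cbinom z n‖ * (n : ℝ) ^ (z.re + 1)) atTop
      (𝓝 (1 / ‖Complex.Gamma (-z)‖)) := by
  have hG : Complex.Gamma (-z) ≠ 0 := by
    apply Complex.Gamma_ne_zero
    intro m hm
    exact hz m (neg_injective hm)
  have h1 := (Complex.GammaSeq_tendsto_Gamma (-z)).norm
  have h2 : Tendsto (fun n : ℕ => ‖z / (n : ℂ) - 1‖) atTop (𝓝 1) := by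
    have : Tendsto (fun n : ℕ => z / (n : ℂ) - 1) atTop (𝓝 (0 - 1)) :=
      (tendsto_const_div_atTop_nhds_zero_nat z).sub_const 1
    simpa using this.norm
  have h3 := (h1.mul h2)
  rw [mul_one] at h3
  have h4 := h3.inv₀ (by simpa using hG)
  rw [one_div]
  refine h4.congr' ?_
  filter_upwards [eventually_gt_atTop 0] with n hn
  have hn' : (0 : ℝ) < n := by exact_mod_cast hn
  have hnc : (n : ℂ) ≠ 0 := by exact_mod_cast hn.ne'
  have hzn : z - n ≠ 0 := sub_ne_zero.2 (hz n)
  have hprod : ∏ j ∈ Finset.range (n + 1), (-z + (j : ℂ)) =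
      (-1) ^ (n + 1) * ((∏ j ∈ Finset.range n, (z - (j : ℂ))) * (z - n)) := by
    rw [← Finset.prod_range_succ, ← Finset.card_range (n + 1), ← Finset.prod_const,
      Finset.card_range, ← Finset.prod_mul_distrib]
    apply Finset.prod_congr rfl
    intros; ring
  have hp0 : ∏ j ∈ Finset.range n, (z - (j : ℂ)) ≠ 0 :=
    Finset.prod_ne_zero_iff.2 fun j _ => sub_ne_zero.2 (hz j)
  have hf : (n.factorial : ℂ) ≠ 0 := by exact_mod_cast n.factorial_ne_zero
  have hnorm : ‖(n : ℂ) ^ (-z)‖ = (n : ℝ) ^ (-z.re) := by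
    rw [← Complex.ofReal_natCast, Complex.norm_cpow_eq_rpow_re_of_pos hn']; simp
  rw [Complex.GammaSeq, hprod, cbinom]
  have e1 : z / (n : ℂ) - 1 = (z - n) / n := by field_simp
  rw [e1]
  simp only [norm_div, norm_mul, norm_pow, norm_neg, norm_one, one_pow, one_mul, hnorm]
  have a1 : ‖∏ j ∈ Finset.range n, (z - (j : ℂ))‖ ≠ 0 := norm_ne_zero_iff.2 hp0
  have a2 : ‖(n.factorial : ℂ)‖ ≠ 0 := norm_ne_zero_iff.2 hf
  have a3 : ‖z - (n : ℂ)‖ ≠ 0 := norm_ne_zero_iff.2 hzn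
  have a4 : ‖(n : ℂ)‖ = n := by simp
  rw [a4, Real.rpow_neg hn'.le, Real.rpow_add hn', Real.rpow_one]
  have a5 : (n : ℝ) ^ z.re ≠ 0 := (Real.rpow_pos_of_pos hn' _).ne'
  field_simp

open Filter Topology Asymptotics in
lemma cbinom_isTheta (z : ℂ) (hz : ∀ n : ℕ, z ≠ (n : ℂ)) :
    (fun n : ℕ => cbinom z n) =Θ[atTop] fun n : ℕ => (n : ℝ) ^ (-z.re - 1) := by
  have hG : Complex.Gamma (-z) ≠ 0 := by
    apply Complex.Gamma_ne_zero
    intro m hm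
    exact hz m (neg_injective hm)
  have hne : (1 / ‖Complex.Gamma (-z)‖) ≠ 0 := by
    simpa using hG
  have h : (fun n : ℕ => ‖cbinom z n‖) =Θ[atTop] fun n : ℕ => (n : ℝ) ^ (-z.re - 1) := by
    apply IsTheta.symm
    refine isTheta_of_div_tendsto_nhds_ne_zero ?_ hne
    refine (cbinom_tendsto z hz).congr' ?_
    filter_upwards [eventually_gt_atTop 0] with n hn
    have hn' : (0 : ℝ) < n := by exact_mod_cast hn
    rw [show -z.re - 1 = -(z.re + 1) by ring, Real.rpow_neg hn'.le, div_inv_eq_mul]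
  exact isTheta_norm_left.1 h

open Filter Topology Asymptotics in
lemma Hr_isBigO (k : ℕ) (ε : ℝ) (hε : 0 < ε) :
    (fun n : ℕ => Hr n ^ k) =O[atTop] fun n : ℕ => (n : ℝ) ^ ε := by
  have hH : ∀ n, Hr n = ((harmonic n : ℚ) : ℝ) := by
    intro n; simp [Hr, harmonic]
  have h1 : (fun n : ℕ => Hr n) =O[atTop] fun n : ℕ => (n : ℝ) ^ (ε / (k + 1)) := by
    have hp : 0 < ε / (k + 1) := by positivity
    have hlog : (fun n : ℕ => Real.log n) =O[atTop] fun n : ℕ => (n : ℝ) ^ (ε / (k + 1)) :=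
      ((isLittleO_log_rpow_atTop hp).comp_tendsto tendsto_natCast_atTop_atTop).isBigO
    have hone : (fun _ : ℕ => (1 : ℝ)) =O[atTop] fun n : ℕ => (n : ℝ) ^ (ε / (k + 1)) := by
      apply IsBigO.of_bound 1
      filter_upwards [eventually_ge_atTop 1] with n hn
      have : (1 : ℝ) ≤ n := by exact_mod_cast hn
      have := Real.one_le_rpow this hp.le
      rw [norm_one, one_mul, Real.norm_of_nonneg (by linarith)]
      exact this
    refine IsBigO.trans ?_ (hone.add hlog)
    apply IsBigO.of_bound 1
    filter_upwards [eventually_ge_atTop 1] with n hn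
    have h2 := harmonic_le_one_add_log n
    have h3 : 0 ≤ Hr n := Finset.sum_nonneg (fun i _ => by positivity)
    rw [← hH] at h2
    rw [Real.norm_of_nonneg h3, Real.norm_of_nonneg (by linarith), one_mul]
    exact h2
  have h2 := h1.pow k
  refine h2.trans ?_
  apply IsBigO.of_bound 1
  filter_upwards [eventually_ge_atTop 1] with n hn
  have hn1 : (1 : ℝ) ≤ n := by exact_mod_cast hn
  rw [← Real.rpow_mul_natCast (by linarith), one_mul, Real.norm_of_nonneg (by positivity),
    Real.norm_of_nonneg (by positivity)]
  apply Real.rpow_le_rpow_of_exponent_le hn1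
  rw [div_mul_eq_mul_div, div_le_iff₀ (by positivity)]
  nlinarith

open Filter Topology Asymptotics in
lemma abel_conv (t r : ℕ → ℂ) (L : ℂ)
    (ht : Tendsto (fun N => ∑ n ∈ Finset.range N, t n) atTop (𝓝 L))
    (hr : Tendsto r atTop (𝓝 0)) (hs : Summable fun n => ‖r (n + 1) - r n‖) :
    CauchySeq fun N => ∑ n ∈ Finset.range N, r n * t n := by
  obtain ⟨b, hb⟩ : ∃ b, ∀ N, ‖∑ n ∈ Finset.range N, t n‖ ≤ b := by
    obtain ⟨b, hb⟩ := (Metric.isBounded_range_of_tendsto _ ht).exists_norm_le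
    exact ⟨b, fun N => hb _ ⟨N, rfl⟩⟩
  rw [← cauchySeq_shift 1]
  simp_rw [← smul_eq_mul]
  simp_rw [Finset.sum_range_by_parts _ _ (Nat.succ _), sub_eq_add_neg, Nat.succ_sub_succ_eq_sub,
    tsub_zero]
  apply (NormedField.tendsto_zero_smul_of_tendsto_zero_of_bounded hr
    ⟨b, eventually_map.mpr <| Eventually.of_forall fun n ↦ hb <| n + 1⟩).cauchySeq.add
  refine CauchySeq.neg ?_
  have hsum : Summable fun i => (r (i + 1) + -r i) • ∑ n ∈ Finset.range (i + 1), t n := by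
    refine Summable.of_norm_bounded (hs.mul_right b) ?_
    intro i
    rw [norm_smul, ← sub_eq_add_neg]
    exact mul_le_mul_of_nonneg_left (hb _) (norm_nonneg _)
  exact hsum.hasSum.tendsto_sum_nat.cauchySeq

lemma cbinom_succ (z : ℂ) (n : ℕ) : cbinom z (n + 1) = cbinom z n * ((z - n) / (n + 1)) := by
  have : (n : ℂ) + 1 ≠ 0 := Nat.cast_add_one_ne_zero n
  have hf : (n.factorial : ℂ) ≠ 0 := by exact_mod_cast n.factorial_ne_zero
  rw [cbinom, cbinom, Finset.prod_range_succ, Nat.factorial_succ]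
  push_cast
  field_simp

lemma cbinom_ne_zero (z : ℂ) (hz : ∀ n : ℕ, z ≠ (n : ℂ)) (n : ℕ) : cbinom z n ≠ 0 := by
  have hp0 : ∏ j ∈ Finset.range n, (z - (j : ℂ)) ≠ 0 :=
    Finset.prod_ne_zero_iff.2 fun j _ => sub_ne_zero.2 (hz j)
  have hf : (n.factorial : ℂ) ≠ 0 := by exact_mod_cast n.factorial_ne_zero
  exact div_ne_zero hp0 hf

lemma cbinom_neg_real (y : ℝ) (hy : y < 0) (n : ℕ) :
    (-1 : ℂ) ^ n * cbinom (y : ℂ) n = ((‖cbinom (y : ℂ) n‖ : ℝ) : ℂ) := by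
  induction n with
  | zero => simp [cbinom]
  | succ n ih =>
    rw [cbinom_succ, pow_succ, norm_mul, Complex.ofReal_mul, ← ih]
    have : ‖((y : ℂ) - n) / (n + 1)‖ = (n - y) / (n + 1) := by
      have h : ((y : ℂ) - n) / (n + 1) = (((y - n) / (n + 1) : ℝ) : ℂ) := by push_cast; ring
      have hn : (0 : ℝ) ≤ n := by positivity
      rw [h, Complex.norm_real, Real.norm_eq_abs, abs_div, abs_of_neg (by linarith),
        abs_of_pos (by linarith)]
      ring
    rw [this]
    push_cast; ring

open Filter Topology Asymptotics in
lemma rpow_combine (a b c : ℝ) (h : a + b = c) :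
    (fun n : ℕ => (n : ℝ) ^ a * (n : ℝ) ^ b) =ᶠ[atTop] fun n : ℕ => (n : ℝ) ^ c := by
  filter_upwards [eventually_gt_atTop 0] with n hn
  have hn' : (0 : ℝ) < n := by exact_mod_cast hn
  rw [← Real.rpow_add hn', h]

open Filter Topology Asymptotics in
lemma newton_transfer (c : ℕ → ℂ) (z w L : ℂ) (hz : ∀ n : ℕ, z ≠ (n : ℂ))
    (hw : ∀ n : ℕ, w ≠ (n : ℂ)) (hlt : z.re < w.re) (h : NewtonSeriesTo c z L) :
    ∃ M, NewtonSeriesTo c w M := by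
  set r : ℕ → ℂ := fun n => cbinom w n / cbinom z n with hr
  have hrO : r =O[atTop] fun n : ℕ => (n : ℝ) ^ (z.re - w.re) := by
    have h1 := ((cbinom_isTheta w hw).div (cbinom_isTheta z hz)).1
    refine h1.trans_eventuallyEq ?_
    filter_upwards [eventually_gt_atTop 0] with n hn
    have hn' : (0 : ℝ) < n := by exact_mod_cast hn
    rw [← Real.rpow_sub hn']
    congr 1; ring
  have hr0 : Tendsto r atTop (𝓝 0) := by
    refine hrO.trans_tendsto ?_
    have := (tendsto_rpow_neg_atTop (show 0 < w.re - z.re by linarith)).comp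
      (tendsto_natCast_atTop_atTop (R := ℝ))
    simpa [Function.comp_def] using this
  have hd : ∀ n, r (n + 1) - r n = r n * ((w - z) / (z - n)) := by
    intro n
    have h1 := cbinom_ne_zero z hz n
    have h2 : z - n ≠ 0 := sub_ne_zero.2 (hz n)
    have : (n : ℂ) + 1 ≠ 0 := Nat.cast_add_one_ne_zero n
    simp only [hr, cbinom_succ]
    field_simp
    ring
  have hq : (fun n : ℕ => (w - z) / (z - n)) =O[atTop] fun n : ℕ => (n : ℝ) ^ (-1 : ℝ) := by
    apply IsBigO.of_bound (2 * ‖w - z‖)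
    filter_upwards [eventually_gt_atTop 0,
      tendsto_natCast_atTop_atTop.eventually_ge_atTop (2 * ‖z‖)] with n hn hn2
    have hn' : (0 : ℝ) < n := by exact_mod_cast hn
    have h1 : (n : ℝ) / 2 ≤ ‖z - n‖ := by
      have := norm_sub_norm_le (n : ℂ) z
      rw [norm_sub_rev] at this
      simp only [Complex.norm_natCast] at this
      linarith
    rw [Real.rpow_neg_one, norm_div, norm_inv, Real.norm_of_nonneg hn'.le,
      div_le_iff₀ (by linarith)]
    have : 2 * ‖w - z‖ * (n : ℝ)⁻¹ * ((n : ℝ) / 2) = ‖w - z‖ := by field_simp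
    calc ‖w - z‖ = 2 * ‖w - z‖ * (n : ℝ)⁻¹ * ((n : ℝ) / 2) := this.symm
      _ ≤ _ := by gcongr
  have hsum : Summable fun n => ‖r (n + 1) - r n‖ := by
    have hO : (fun n => ‖r (n + 1) - r n‖) =O[atTop]
        fun n : ℕ => (n : ℝ) ^ (z.re - w.re - 1) := by
      apply IsBigO.norm_left
      simp_rw [hd]
      exact (hrO.mul hq).trans_eventuallyEq (rpow_combine _ _ _ (by ring))
    exact summable_of_isBigO_nat (Real.summable_nat_rpow.2 (by linarith)) hO
  have hc := abel_conv (fun n => (-1 : ℂ) ^ n * c n * cbinom z n) r L h hr0 hsum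
  obtain ⟨M, hM⟩ := cauchySeq_tendsto_of_complete hc
  refine ⟨M, hM.congr ?_⟩
  intro N
  apply Finset.sum_congr rfl
  intro n _
  have h1 := cbinom_ne_zero z hz n
  simp only [hr]
  field_simp

open Filter Topology Asymptotics in
lemma newton_conv (c : ℕ → ℂ) (e : ℕ → ℝ) (k h : ℕ) (hc : ∀ n, c n = -(e n : ℂ))
    (he : ∀ n, 0 ≤ e n)
    (hu : ∀ n, e (n + 1) ≤ Hr (n + 1) ^ k / ((n + 1 : ℕ) : ℝ) ^ h)
    (z : ℂ) (hz : -(h : ℝ) < z.re) : ∃ L, NewtonSeriesTo c z L := by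
  by_cases hzn : ∀ n : ℕ, z ≠ (n : ℂ)
  · have hε : 0 < (h + z.re) / 2 := by linarith
    have heO : c =O[atTop] fun n : ℕ => (n : ℝ) ^ ((h + z.re) / 2 - h) := by
      have h1 : c =O[atTop] fun n : ℕ => Hr n ^ k * (n : ℝ) ^ (-(h : ℝ)) := by
        apply IsBigO.of_bound 1
        filter_upwards [eventually_gt_atTop 0] with n hn
        obtain ⟨m, rfl⟩ : ∃ m, n = m + 1 := ⟨n - 1, by omega⟩
        rw [hc, norm_neg, Complex.norm_real, Real.norm_of_nonneg (he _), one_mul,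
          Real.rpow_neg (by positivity), Real.rpow_natCast, ← div_eq_mul_inv]
        exact (hu m).trans (le_abs_self _)
      refine h1.trans (((Hr_isBigO k _ hε).mul (isBigO_refl _ _)).trans_eventuallyEq
        (rpow_combine _ _ _ (by ring)))
    have hS : Summable fun n => (-1 : ℂ) ^ n * c n * cbinom z n := by
      have hO : (fun n => (-1 : ℂ) ^ n * c n * cbinom z n) =O[atTop]
          fun n : ℕ => (n : ℝ) ^ (-(h + z.re) / 2 - 1) := by
        have h2 := (heO.mul (cbinom_isTheta z hzn).1).trans_eventuallyEq
          (rpow_combine _ _ (-(h + z.re) / 2 - 1) (by ring))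
        refine IsBigO.trans ?_ h2
        apply IsBigO.of_bound 1
        filter_upwards with n
        simp
      exact summable_of_isBigO_nat (Real.summable_nat_rpow.2 (by linarith)) hO
    exact ⟨_, hS.hasSum.tendsto_sum_nat⟩
  · push Not at hzn
    obtain ⟨m, rfl⟩ := hzn
    have hS : Summable fun n => (-1 : ℂ) ^ n * c n * cbinom (m : ℂ) n := by
      apply summable_of_ne_finset_zero (s := Finset.range (m + 1))
      intro n hn
      have hn' : m < n := by simpa using hn
      have : ∏ j ∈ Finset.range n, ((m : ℂ) - (j : ℂ)) = 0 :=
        Finset.prod_eq_zero (Finset.mem_range.2 hn') (by simp)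
      simp [cbinom, this]
    exact ⟨_, hS.hasSum.tendsto_sum_nat⟩

open Filter Topology Asymptotics in
lemma newton_div (c : ℕ → ℂ) (e : ℕ → ℝ) (h : ℕ) (hc : ∀ n, c n = -(e n : ℂ))
    (he : ∀ n, 0 ≤ e n)
    (hl : ∀ n, 1 / ((n + 1 : ℕ) : ℝ) ^ h ≤ e (n + 1))
    (z : ℂ) (hzn : ∀ n : ℕ, z ≠ (n : ℂ)) (hz : z.re < -(h : ℝ)) :
    ¬ ∃ L, NewtonSeriesTo c z L := by
  rintro ⟨L, hL⟩
  obtain ⟨y, hy1, hy2⟩ := exists_between hz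
  have hh0 : (0 : ℝ) ≤ h := by positivity
  have hy0 : y < 0 := by linarith
  have hyn : ∀ n : ℕ, (y : ℂ) ≠ (n : ℂ) := by
    intro n hn
    have : y = n := by exact_mod_cast hn
    have : (0 : ℝ) ≤ n := by positivity
    linarith
  obtain ⟨M, hM⟩ := newton_transfer c z y L hzn hyn (by simpa using hy1) hL
  set u : ℕ → ℝ := fun n => e n * ‖cbinom (y : ℂ) n‖ with hu
  have hu0 : ∀ n, 0 ≤ u n := fun n => mul_nonneg (he n) (norm_nonneg _)
  have hterm : ∀ n, (-1 : ℂ) ^ n * c n * cbinom (y : ℂ) n = ((-u n : ℝ) : ℂ) := by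
    intro n
    have := cbinom_neg_real y hy0 n
    rw [hc, hu]
    push_cast
    rw [← this]; ring
  have hsum : Summable u := by
    obtain ⟨b, hb⟩ := (Metric.isBounded_range_of_tendsto _ hM).exists_norm_le
    apply summable_of_sum_range_le hu0 (c := b)
    intro n
    have h1 := hb _ ⟨n, rfl⟩
    simp only [hterm] at h1
    rw [← Complex.ofReal_sum, Complex.norm_real, Finset.sum_neg_distrib, norm_neg,
      Real.norm_of_nonneg (Finset.sum_nonneg fun i _ => hu0 i)] at h1
    exact h1
  have hO : (fun n : ℕ => (n : ℝ) ^ (-(h : ℝ) - y - 1)) =O[atTop] u := by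
    have h1 : (fun n : ℕ => (n : ℝ) ^ (-(h : ℝ))) =O[atTop] e := by
      apply IsBigO.of_bound 1
      filter_upwards [eventually_gt_atTop 0] with n hn
      obtain ⟨m, rfl⟩ : ∃ m, n = m + 1 := ⟨n - 1, by omega⟩
      rw [Real.norm_of_nonneg (he _), one_mul, Real.norm_of_nonneg (by positivity),
          Real.rpow_neg (by positivity), Real.rpow_natCast, ← one_div]
      exact hl m
    have h2 := (cbinom_isTheta (y : ℂ) hyn).2.norm_right
    rw [Complex.ofReal_re] at h2
    exact (rpow_combine _ _ _ (by ring)).symm.trans_isBigO (h1.mul h2)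
  have := Real.summable_nat_rpow.1 (summable_of_isBigO_nat hsum hO)
  linarith

/-- The Newton series `F_α` converges for every `z` with
`Re z > -α*₁` and diverges for every `z ∉ ℕ` with `Re z < -α*₁`; i.e. its abscissa of
convergence is `-α*₁`, where `α* = (α*₁,…,α*_t)` is the dual of `α`. -/
theorem newton_series_abscissa (α : List ℕ) (hα : MIdx α) :
    (∀ z : ℂ, -(((dualIdx α).headI : ℝ)) < z.re →
      ∃ L, NewtonSumsTo (fun n => (hsum α n : ℂ)) z L) ∧
    (∀ z : ℂ, (∀ n : ℕ, z ≠ (n : ℂ)) → z.re < -(((dualIdx α).headI : ℝ)) →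
      ¬ ∃ L, NewtonSumsTo (fun n => (hsum α n : ℂ)) z L) := by
  obtain ⟨e, k, hc, he, hl, hu⟩ := newton_coeffs α hα
  exact ⟨fun z hz => newton_conv _ e k _ hc he hu z hz,
    fun z hzn hz => newton_div _ e _ hc he hl z hzn hz⟩
end

section
/- Let a, b : ℕ → ℂ be sequences and ρ ∈ ℝ. Suppose the Newton series f(z) = Σ_{n=0}^∞ (−1)^n (∇a)(n)·binom(z,n) and g(z) = Σ_{n=0}^∞ (−1)^n (∇b)(n)·binom(z,n) both converge for every z ∈ ℂ with Re z > ρ. If there exists N ∈ ℕ such that f(n) = g(n) for every integer n ≥ N, then f(z) = g(z) for every z with Re z > ρ. -/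
open scoped BigOperators

section NewtonAux
open Filter Topology

lemma newtonAux_delOp_iter (a : ℕ → ℂ) (n : ℕ) :
    delOp^[n] a = (-1 : ℂ) ^ n • (fwdDiff 1)^[n] a := by
  induction n with
  | zero => simp
  | succ n ih =>
    rw [Function.iterate_succ_apply', ih, Function.iterate_succ_apply']
    ext m
    simp only [delOp, fwdDiff, Pi.smul_apply, smul_eq_mul, pow_succ]
    ring

lemma newtonAux_cbinom_nat (n k : ℕ) : cbinom (n : ℂ) k = (n.choose k : ℂ) := by
  have h : ∏ i ∈ Finset.range k, ((n : ℂ) - (i : ℂ)) = (n.descFactorial k : ℂ) := by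
    rw [← descPochhammer_eval_eq_descFactorial, descPochhammer_eval_eq_prod_range]
  rw [cbinom, h, Nat.descFactorial_eq_factorial_mul_choose]
  have : (k.factorial : ℂ) ≠ 0 := by exact_mod_cast k.factorial_ne_zero
  push_cast
  field_simp

lemma newtonAux_cbinom_succ (z : ℂ) (n : ℕ) :
    cbinom z (n + 1) * ((n : ℂ) + 1) = cbinom z n * (z - n) := by
  have h1 : (n.factorial : ℂ) ≠ 0 := by exact_mod_cast n.factorial_ne_zero
  have h2 : (n : ℂ) + 1 ≠ 0 := by exact_mod_cast n.succ_ne_zero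
  simp only [cbinom, Finset.prod_range_succ, Nat.factorial_succ]
  push_cast
  field_simp

lemma newtonAux_value (a : ℕ → ℂ) (n : ℕ) :
    ∑ k ∈ Finset.range (n + 1), (-1 : ℂ) ^ k * nablaOp a k * cbinom (n : ℂ) k = a n := by
  have h := shift_eq_sum_fwdDiff_iter (1 : ℕ) a n 0
  simp only [smul_eq_mul, mul_one, zero_add] at h
  rw [h]
  refine Finset.sum_congr rfl fun k _ => ?_
  rw [newtonAux_cbinom_nat, nablaOp, newtonAux_delOp_iter]
  simp only [Pi.smul_apply, smul_eq_mul, nsmul_eq_mul]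
  have : (-1 : ℂ) ^ k * (-1 : ℂ) ^ k = 1 := by rw [← mul_pow]; simp
  linear_combination ((fwdDiff 1)^[k] a 0 * (n.choose k : ℂ)) * this

lemma newtonAux_nabla (d : ℕ → ℂ) (D : ℕ) (hd : ∀ n, D < n → d n = 0) (n : ℕ) :
    nablaOp d n = ∑ k ∈ Finset.range (D + 1), (-1 : ℂ) ^ k * d k * (n.choose k : ℂ) := by
  have h1 : nablaOp d n =
      ∑ k ∈ Finset.range (n + 1), (-1 : ℂ) ^ k * d k * (n.choose k : ℂ) := by
    rw [nablaOp, newtonAux_delOp_iter]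
    simp only [Pi.smul_apply, smul_eq_mul, fwdDiff_iter_eq_sum_shift, Finset.mul_sum, zero_add,
      mul_one]
    refine Finset.sum_congr rfl fun k hk => ?_
    have hk' : k ≤ n := by simpa [Nat.lt_succ_iff] using hk
    obtain ⟨m, rfl⟩ := Nat.exists_eq_add_of_le hk'
    have : (-1 : ℂ) ^ m * (-1 : ℂ) ^ m = 1 := by rw [← mul_pow]; simp
    simp only [Nat.add_sub_cancel_left, zsmul_eq_mul, pow_add]
    push_cast
    linear_combination ((-1 : ℂ) ^ k * d k * ((k + m).choose k : ℂ)) * this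
  rw [h1]
  rcases le_total n D with h | h
  · refine Finset.sum_subset (by simpa using h) fun k _ hk => ?_
    rw [Nat.choose_eq_zero_of_lt (by simpa using hk)]; simp
  · refine (Finset.sum_subset (by simpa using h) fun k _ hk => ?_).symm
    rw [hd k (by simpa using hk)]; simp

lemma newtonAux_T (z : ℂ) (k M : ℕ) :
    (z - k) * ∑ n ∈ Finset.range M, (-1 : ℂ) ^ n * (n.choose k : ℂ) * cbinom z n =
      -((-1 : ℂ) ^ M * cbinom z M * ((k + 1) * (M.choose (k + 1) : ℂ))) := by
  induction M with
  | zero => simp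
  | succ M ih =>
    rw [Finset.sum_range_succ, mul_add, ih]
    have h1 : ((M.choose (k + 1) : ℂ)) * (k + 1) = (M.choose k : ℂ) * ((M : ℂ) - k) := by
      rcases le_or_gt k M with h | h
      · rw [← Nat.cast_sub h]; exact_mod_cast Nat.choose_succ_right_eq M k
      · rw [Nat.choose_eq_zero_of_lt h, Nat.choose_eq_zero_of_lt (by omega)]; simp
    have h2 : ((M : ℂ) + 1) * (M.choose k : ℂ) = ((M + 1).choose (k + 1) : ℂ) * (k + 1) := by
      exact_mod_cast Nat.add_one_mul_choose_eq M k
    have h3 := newtonAux_cbinom_succ z M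
    rw [pow_succ]
    linear_combination (-(-1 : ℂ) ^ M * cbinom z M) * h1 +
      ((-1 : ℂ) ^ M * cbinom z (M + 1)) * h2 - ((-1 : ℂ) ^ M * (M.choose k : ℂ)) * h3

/-- Partial sums of the Newton series. -/
noncomputable def newtonAuxS (d : ℕ → ℂ) (z : ℂ) (M : ℕ) : ℂ :=
  ∑ n ∈ Finset.range M, (-1 : ℂ) ^ n * nablaOp d n * cbinom z n

lemma newtonAux_S (d : ℕ → ℂ) (D : ℕ) (hd : ∀ n, D < n → d n = 0) (z : ℂ)
    (hz : ∀ k : ℕ, z ≠ k) (m : ℕ) :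
    newtonAuxS d z (m + 1) = (-1 : ℂ) ^ m * cbinom z (m + 1) * (m + 1) *
      ∑ k ∈ Finset.range (D + 1), (-1 : ℂ) ^ k * d k / (z - k) * (m.choose k : ℂ) := by
  have h1 : newtonAuxS d z (m + 1) = ∑ k ∈ Finset.range (D + 1), (-1 : ℂ) ^ k * d k *
      ∑ n ∈ Finset.range (m + 1), (-1 : ℂ) ^ n * (n.choose k : ℂ) * cbinom z n := by
    simp only [newtonAuxS, newtonAux_nabla d D hd, Finset.mul_sum, Finset.sum_mul]
    rw [Finset.sum_comm]
    refine Finset.sum_congr rfl fun k _ => Finset.sum_congr rfl fun n _ => ?_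
    ring
  rw [h1, Finset.mul_sum]
  refine Finset.sum_congr rfl fun k _ => ?_
  have hzk : z - k ≠ 0 := sub_ne_zero.mpr (hz k)
  have h2 : ((m : ℂ) + 1) * (m.choose k : ℂ) = ((m + 1).choose (k + 1) : ℂ) * (k + 1) := by
    exact_mod_cast Nat.add_one_mul_choose_eq m k
  have h3 := newtonAux_T z k (m + 1)
  field_simp
  rw [pow_succ] at h3
  linear_combination d k * h3 - (d k * (-1 : ℂ) ^ m * cbinom z (m + 1)) * h2

lemma newtonAux_choose (k : ℕ) :
    Tendsto (fun m : ℕ => (m.choose k : ℂ) / (m : ℂ) ^ k) atTop (𝓝 (1 / (k.factorial : ℂ))) := by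
  have h : Tendsto (fun n : ℕ => (n : ℝ) * ((n : ℝ)⁻¹)) atTop (𝓝 1) := by
    refine tendsto_const_nhds.congr' ?_
    filter_upwards [eventually_gt_atTop 0] with n hn
    have : (n : ℝ) ≠ 0 := by positivity
    field_simp
  have h2 := ProbabilityTheory.tendsto_choose_mul_pow_atTop k h
  have h3 := (Complex.continuous_ofReal.tendsto _).comp h2
  refine (h3.congr fun n => ?_).trans (by simp)
  simp [div_eq_mul_inv]

lemma newtonAux_poly (e : ℕ → ℂ) (D : ℕ) :
    Tendsto (fun m : ℕ => (∑ k ∈ Finset.range (D + 1), e k * (m.choose k : ℂ)) / (m : ℂ) ^ D)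
      atTop (𝓝 (e D / (D.factorial : ℂ))) := by
  have h0 : ∀ k ∈ Finset.range D,
      Tendsto (fun m : ℕ => e k * (m.choose k : ℂ) / (m : ℂ) ^ D) atTop (𝓝 0) := by
    intro k hk
    have hk' : k < D := by simpa using hk
    have h1 : Tendsto (fun m : ℕ => ((m : ℂ)⁻¹) ^ (D - k)) atTop (𝓝 0) := by
      have := (tendsto_inv_atTop_nhds_zero_nat (𝕜 := ℂ)).pow (D - k)
      rwa [zero_pow (by omega)] at this
    have h2 := ((newtonAux_choose k).mul h1).const_mul (e k)
    rw [mul_zero, mul_zero] at h2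
    refine h2.congr fun m => ?_
    have : (m : ℂ) ^ D = (m : ℂ) ^ k * (m : ℂ) ^ (D - k) := by
      rw [← pow_add]; congr 1; omega
    rw [this, inv_pow, div_eq_mul_inv, div_eq_mul_inv, mul_inv]
    ring
  have h1 := (tendsto_finsetSum _ h0).add ((newtonAux_choose D).const_mul (e D))
  have h2 : (∑ _k ∈ Finset.range D, (0 : ℂ)) + e D * (1 / (D.factorial : ℂ)) =
    e D / (D.factorial : ℂ) := by simp [div_eq_mul_inv]
  rw [h2] at h1
  refine h1.congr fun m => ?_
  rw [Finset.sum_range_succ, add_div, Finset.sum_div, mul_div_assoc]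

lemma newtonAux_asymp (d : ℕ → ℂ) (D : ℕ) (hd : ∀ n, D < n → d n = 0) (hD : d D ≠ 0) (z : ℂ)
    (hz : ∀ k : ℕ, z ≠ k) :
    ∃ c : ℂ, c ≠ 0 ∧
      Tendsto (fun m : ℕ => newtonAuxS d z (m + 1) * (m : ℂ) ^ (z - D)) atTop (𝓝 c) := by
  have hG : Complex.Gamma (-z) ≠ 0 :=
    Complex.Gamma_ne_zero fun m h => hz m (neg_injective h)
  have hp := newtonAux_poly (fun k => (-1 : ℂ) ^ k * d k / (z - k)) D
  have hg := (Complex.GammaSeq_tendsto_Gamma (-z)).inv₀ hG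
  refine ⟨_, ?_, ((hg.mul hp).neg).congr' ?_⟩
  · have : z - D ≠ 0 := sub_ne_zero.mpr (hz D)
    have h2 : (D.factorial : ℂ) ≠ 0 := by exact_mod_cast D.factorial_ne_zero
    have h3 : (-1 : ℂ) ^ D ≠ 0 := pow_ne_zero _ (by norm_num)
    exact neg_ne_zero.mpr (mul_ne_zero (inv_ne_zero hG)
      (div_ne_zero (div_ne_zero (mul_ne_zero h3 hD) this) h2))
  · filter_upwards [eventually_gt_atTop 0] with m hm
    have hm0 : (m : ℂ) ≠ 0 := by exact_mod_cast hm.ne'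
    rw [newtonAux_S d D hd z hz]
    have hprod : ∏ j ∈ Finset.range (m + 1), (-z + (j : ℂ)) =
        (-1) ^ (m + 1) * (cbinom z (m + 1) * ((m + 1) * (m.factorial : ℂ))) := by
      have h2 : ((m + 1).factorial : ℂ) ≠ 0 := by exact_mod_cast (m + 1).factorial_ne_zero
      have h4 : ((m : ℂ) + 1) * (m.factorial : ℂ) = ((m + 1).factorial : ℂ) := by
        rw [Nat.factorial_succ]; push_cast; ring
      rw [h4, cbinom, div_mul_cancel₀ _ h2]
      have : ∀ j ∈ Finset.range (m + 1), (-z + (j : ℂ)) = (-1) * (z - j) := fun j _ => by ring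
      rw [Finset.prod_congr rfl this, Finset.prod_mul_distrib]
      simp
    have h2 : (m.factorial : ℂ) ≠ 0 := by exact_mod_cast m.factorial_ne_zero
    rw [Complex.GammaSeq, hprod, Complex.cpow_sub _ _ hm0, Complex.cpow_neg, Complex.cpow_natCast,
      pow_succ]
    have h5 : (m : ℂ) ^ z ≠ 0 := by simp [Complex.cpow_eq_zero_iff, hm0]
    field_simp
    try ring

lemma newtonAux_cpow_zero (w : ℂ) (hw : w.re < 0) :
    Tendsto (fun m : ℕ => (m : ℂ) ^ w) atTop (𝓝 0) := by
  rw [tendsto_zero_iff_norm_tendsto_zero]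
  have h := (tendsto_rpow_neg_atTop (y := -w.re) (by linarith)).comp tendsto_natCast_atTop_atTop
  refine h.congr' ?_
  filter_upwards [eventually_gt_atTop 0] with m hm
  simp [Complex.norm_natCast_cpow_of_pos hm]

lemma newtonAux_main (d : ℕ → ℂ) (ρ : ℝ)
    (hconv : ∀ z : ℂ, ρ < z.re → ∃ L, Tendsto (newtonAuxS d z) atTop (𝓝 L))
    (N : ℕ) (hN : ∀ n, N ≤ n → d n = 0) (z : ℂ) (hz : ρ < z.re) :
    Tendsto (newtonAuxS d z) atTop (𝓝 0) := by
  classical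
  by_cases h0 : ∀ n, d n = 0
  · have : newtonAuxS d z = fun _ => 0 := by
      ext M
      simp [newtonAuxS, newtonAux_nabla d 0 (fun n _ => h0 n), h0]
    rw [this]; exact tendsto_const_nhds
  push Not at h0
  obtain ⟨n0, hn0⟩ := h0
  have hn0N : n0 ≤ N := by
    by_contra h; exact hn0 (hN _ (by omega))
  obtain ⟨D, hD, hd⟩ : ∃ D, d D ≠ 0 ∧ ∀ n, D < n → d n = 0 := by
    refine ⟨Nat.findGreatest (fun n => d n ≠ 0) N,
      Nat.findGreatest_spec (P := fun n => d n ≠ 0) hn0N hn0, fun n hn => ?_⟩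
    rcases le_or_gt n N with h | h
    · by_contra h'; exact Nat.findGreatest_is_greatest hn h h'
    · exact hN n h.le
  have hρ : (D : ℝ) ≤ ρ := by
    by_contra! hlt
    obtain ⟨x, hx1, hx2⟩ := exists_between (max_lt hlt (sub_one_lt (D : ℝ)))
    have hxρ : ρ < x := lt_of_le_of_lt (le_max_left _ _) hx1
    have hxD : (D : ℝ) - 1 < x := lt_of_le_of_lt (le_max_right _ _) hx1
    have hxn : ∀ k : ℕ, (x : ℂ) ≠ k := by
      intro k hk
      have hk' : x = k := by exact_mod_cast hk
      rw [hk'] at hx2 hxD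
      have h1 : k < D := by exact_mod_cast hx2
      have h2 : (D : ℝ) < k + 1 := by linarith
      have h3 : D < k + 1 := by exact_mod_cast h2
      omega
    obtain ⟨c, hc, hlim⟩ := newtonAux_asymp d D hd hD x hxn
    obtain ⟨L, hL⟩ := hconv x (by simpa using hxρ)
    have h1 := ((tendsto_add_atTop_iff_nat 1).mpr hL).mul
      (newtonAux_cpow_zero ((x : ℂ) - D) (by simpa using hx2))
    rw [mul_zero] at h1
    exact hc (tendsto_nhds_unique hlim h1)
  by_cases hzn : ∃ k : ℕ, z = k
  · obtain ⟨k, rfl⟩ := hzn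
    have hk : D < k := by
      have : (D : ℝ) < k := lt_of_le_of_lt hρ (by simpa using hz)
      exact_mod_cast this
    refine tendsto_const_nhds.congr' ?_
    filter_upwards [eventually_ge_atTop (k + 1)] with M hM
    rw [← hd k hk, ← newtonAux_value d k, newtonAuxS]
    refine Finset.sum_subset (by simpa using hM) fun n _ hn => ?_
    rw [newtonAux_cbinom_nat, Nat.choose_eq_zero_of_lt (by simpa using hn)]; simp
  · push Not at hzn
    obtain ⟨c, hc, hlim⟩ := newtonAux_asymp d D hd hD z hzn
    have h1 := hlim.mul (newtonAux_cpow_zero ((D : ℂ) - z)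
      (by simpa using lt_of_le_of_lt hρ hz))
    rw [mul_zero] at h1
    refine (tendsto_add_atTop_iff_nat 1).mp (h1.congr' ?_)
    filter_upwards [eventually_gt_atTop 0] with m hm
    have hm0 : (m : ℂ) ≠ 0 := by exact_mod_cast hm.ne'
    rw [mul_assoc, ← Complex.cpow_add _ _ hm0]
    simp

lemma newtonAux_sub (a b : ℕ → ℂ) (n : ℕ) : nablaOp (a - b) n = nablaOp a n - nablaOp b n := by
  have h : delOp^[n] (a - b) = delOp^[n] a - delOp^[n] b := by
    induction n with
    | zero => rfl
    | succ n ih =>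
      simp only [Function.iterate_succ_apply', ih]
      ext m
      simp only [delOp, Pi.sub_apply]
      ring
  simp [nablaOp, h]

lemma newtonAux_Ssub (a b : ℕ → ℂ) (z La Lb : ℂ)
    (ha : NewtonSumsTo a z La) (hb : NewtonSumsTo b z Lb) :
    Tendsto (newtonAuxS (a - b) z) atTop (𝓝 (La - Lb)) := by
  refine (Tendsto.sub ha hb).congr fun M => ?_
  rw [newtonAuxS, ← Finset.sum_sub_distrib]
  refine Finset.sum_congr rfl fun n _ => ?_
  rw [newtonAux_sub]; ring

end NewtonAux

/-- If the Newton series interpolating `a` and `b` both converge on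
`Re z > ρ` and their values agree at all integers `n ≥ N` (at `z = n` the Newton series
has value `Σ_{k=0}^n (-1)^k (∇a)(k)·binom(n,k)`), then their sums agree on `Re z > ρ`. -/
theorem newton_series_eq_of_eventually_eq (a b : ℕ → ℂ) (ρ : ℝ)
    (ha : ∀ z : ℂ, ρ < z.re → ∃ L, NewtonSumsTo a z L)
    (hb : ∀ z : ℂ, ρ < z.re → ∃ L, NewtonSumsTo b z L)
    (N : ℕ)
    (hN : ∀ n : ℕ, N ≤ n →
      (∑ k ∈ Finset.range (n + 1), (-1 : ℂ) ^ k * nablaOp a k * cbinom (n : ℂ) k) =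
      (∑ k ∈ Finset.range (n + 1), (-1 : ℂ) ^ k * nablaOp b k * cbinom (n : ℂ) k))
    (z : ℂ) (hz : ρ < z.re) (La Lb : ℂ)
    (hLa : NewtonSumsTo a z La) (hLb : NewtonSumsTo b z Lb) : La = Lb := by
  have hconv : ∀ z : ℂ, ρ < z.re →
      ∃ L, Filter.Tendsto (newtonAuxS (a - b) z) Filter.atTop (nhds L) := by
    intro w hw
    obtain ⟨L1, h1⟩ := ha w hw
    obtain ⟨L2, h2⟩ := hb w hw
    exact ⟨_, newtonAux_Ssub a b w L1 L2 h1 h2⟩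
  have hzero : ∀ n, N ≤ n → (a - b) n = 0 := by
    intro n hn
    have h := hN n hn
    rw [newtonAux_value, newtonAux_value] at h
    simp [h]
  have h := newtonAux_main (a - b) ρ hconv N hzero z hz
  exact sub_eq_zero.mp (tendsto_nhds_unique (newtonAux_Ssub a b z La Lb hLa hLb) h)
end

section
/- For every multi-index α = (α_1,…,α_s) and every integer k ≥ 1, the function G_α is holomorphic at 0 and G_α^{(k)}(0)/k! = (−1)^{k−1} Σ ζ_α( k_1+1,1,…,1, k_2+1,1,…,1, …, k_s+1,1,…,1 ), where the sum is over all (k_1,…,k_s) with k_1+⋯+k_s = k, k_1 ≥ 1 and k_2,…,k_s ≥ 0, and the i-th displayed block (k_i+1,1,…,1) has length α_i. -/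
open scoped BigOperators

/-- Position of the first variable of block `i`. -/
def bst (α : List ℕ) (i : ℕ) : ℕ := (α.take i).sum

lemma mem_boundarySet_iff (α : List ℕ) (j : ℕ) :
    j ∈ boundarySet α ↔ ∃ i, 0 < i ∧ i < α.length ∧ bst α i = j := by
  unfold boundarySet bst
  rw [List.mem_toFinset, List.mem_iff_getElem]
  simp only [List.getElem_dropLast, List.getElem_drop, List.getElem_scanl, List.length_dropLast,
    List.length_drop, List.length_scanl, ← List.sum_eq_foldl]
  constructor
  · rintro ⟨i, hi, h⟩
    exact ⟨1 + i, by omega, by omega, h⟩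
  · rintro ⟨i, h0, hi, h⟩
    exact ⟨i - 1, by omega, by rw [show 1 + (i - 1) = i by omega]; exact h⟩

lemma bst_strict (α : List ℕ) (hα : ∀ a ∈ α, 1 ≤ a) {i j : ℕ} (hij : i < j) (hi : i < α.length) :
    bst α i < bst α j := by
  induction α generalizing i j with
  | nil => simp at hi
  | cons a t ih =>
    have ha : 1 ≤ a := hα a (by simp)
    obtain ⟨j, rfl⟩ : ∃ j', j = j' + 1 := ⟨j - 1, by omega⟩
    cases i with
    | zero => simp [bst]; omega
    | succ i =>
      have := ih (fun x hx => hα x (by simp [hx])) (i := i) (j := j) (by omega) (by simpa using hi)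
      simpa [bst] using this

lemma bst_lt (α : List ℕ) (hα : ∀ a ∈ α, 1 ≤ a) {i : ℕ} (hi : i < α.length) :
    bst α i < α.sum := by
  have := bst_strict α hα hi hi
  simpa [bst] using this

lemma bst_inj (α : List ℕ) (hα : ∀ a ∈ α, 1 ≤ a) {i j : ℕ} (hi : i < α.length)
    (hj : j < α.length) (h : bst α i = bst α j) : i = j := by
  rcases lt_trichotomy i j with h1 | h1 | h1
  · have := bst_strict α hα h1 hi; omega
  · exact h1
  · have := bst_strict α hα h1 hj; omega

lemma blockList_cons (a : ℕ) (t : List ℕ) (ks : Fin (a :: t).length → ℕ) :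
    blockList (a :: t) ks =
      ((ks ⟨0, by simp⟩ + 1) :: List.replicate (a - 1) 1) ++
        blockList t (fun i => ks (Fin.succ i)) := by
  unfold blockList
  simp [List.ofFn_succ]

lemma blockList_bst (α : List ℕ) (hα : ∀ a ∈ α, 1 ≤ a) (ks : Fin α.length → ℕ)
    (i : Fin α.length) : (blockList α ks).getD (bst α i) 1 = ks i + 1 := by
  induction α with
  | nil => exact i.elim0
  | cons a t ih =>
    have ha : 1 ≤ a := hα a (by simp)
    rw [blockList_cons]
    refine Fin.cases ?_ (fun i => ?_) i
    · simp [bst]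
    · have := ih (fun x hx => hα x (by simp [hx])) (fun i => ks (Fin.succ i)) i
      rw [← this, List.getD_append_right]
      · congr 1
        simp [bst]; omega
      · simp [bst]; omega

lemma blockList_not_bst (α : List ℕ) (hα : ∀ a ∈ α, 1 ≤ a) (ks : Fin α.length → ℕ)
    (j : ℕ) (hj : ∀ i < α.length, bst α i ≠ j) : (blockList α ks).getD j 1 = 1 := by
  induction α generalizing j with
  | nil => simp [blockList]
  | cons a t ih =>
    have ha : 1 ≤ a := hα a (by simp)
    rw [blockList_cons]
    by_cases hja : j < a
    · rw [List.getD_append _ _ _ _ (by simp; omega)]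
      obtain ⟨j, rfl⟩ : ∃ j', j = j' + 1 := by
        refine ⟨j - 1, ?_⟩
        have := hj 0 (by simp)
        simp [bst] at this
        omega
      simp
    · rw [List.getD_append_right _ _ _ _ (by simp; omega)]
      apply ih (fun x hx => hα x (by simp [hx]))
      intro i hi h
      apply hj (i + 1) (by simpa using hi)
      simp [bst] at h ⊢
      omega

/-- products over blocks starts -/
lemma prod_starts {R : Type*} [CommMonoid R] (α : List ℕ) (hα : ∀ a ∈ α, 1 ≤ a)
    (h : Fin α.sum → R)
    (hh : ∀ j : Fin α.sum, (∀ i < α.length, bst α i ≠ j) → h j = 1) :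
    ∏ j, h j = ∏ i : Fin α.length, h ⟨bst α i, bst_lt α hα i.2⟩ := by
  classical
  have hinj : Function.Injective (fun i : Fin α.length => (⟨bst α i, bst_lt α hα i.2⟩ : Fin α.sum)) := by
    intro i j hij
    simp only [Fin.mk.injEq] at hij
    exact Fin.ext (bst_inj α hα i.2 j.2 hij)
  rw [← Finset.prod_image (s := Finset.univ)
    (g := fun i : Fin α.length => (⟨bst α i, bst_lt α hα i.2⟩ : Fin α.sum)) (f := h) hinj.injOn]
  symm
  apply Finset.prod_subset (Finset.subset_univ _)
  intro j _ hj
  apply hh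
  intro i hi hij
  apply hj
  simp only [Finset.mem_image, Finset.mem_univ, true_and]
  exact ⟨⟨i, hi⟩, Fin.ext hij⟩

/-- product of absolutely convergent series over tuples -/
lemma pi_hasSum {R : Type*} [NormedCommRing R] [CompleteSpace R] [NormOneClass R] (n : ℕ)
    (f : Fin n → ℕ → R)
    (hf : ∀ i, Summable fun k => ‖f i k‖) :
    (Summable fun v : Fin n → ℕ => ‖∏ i, f i (v i)‖) ∧
      HasSum (fun v : Fin n → ℕ => ∏ i, f i (v i)) (∏ i, ∑' k, f i k) := by
  induction n with
  | zero =>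
    constructor
    · exact (hasSum_fintype _).summable
    · simp
  | succ n ih =>
    obtain ⟨h1, h2⟩ := ih (fun i => f i.succ) (fun i => hf _)
    have e : (fun x : ℕ × (Fin n → ℕ) => ∏ i, f i ((Fin.consEquiv (fun _ => ℕ)) x i))
        = fun x => f 0 x.1 * ∏ i : Fin n, f i.succ (x.2 i) := by
      funext x
      simp [Fin.prod_univ_succ, Fin.consEquiv]
    constructor
    · rw [← (Fin.consEquiv (fun _ => ℕ)).summable_iff]
      have := Summable.mul_norm (hf 0) h1
      have e' := congrArg (fun g => fun x => ‖g x‖) e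
      refine (Summable.congr this ?_)
      intro x
      exact (congrFun e' x).symm
    · rw [← (Fin.consEquiv (fun _ => ℕ)).hasSum_iff]
      have := tsum_mul_tsum_of_summable_norm (hf 0) h1
      rw [Fin.prod_univ_succ, ← h2.tsum_eq, this]
      have hs := (summable_mul_of_summable_norm (hf 0) h1).hasSum
      exact (congrArg (fun g => HasSum g _) e).mpr hs

/-- The summation condition. -/
def Cond (α : List ℕ) (v : Fin α.sum → ℕ) : Prop :=
  (∀ j, 0 < v j) ∧ (∀ j k : Fin α.sum, (k : ℕ) = (j : ℕ) + 1 →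
        (if (k : ℕ) ∈ boundarySet α then v k ≤ v j else v k < v j))

open Classical in
/-- The summand of `zetaIdx α (blockList α ks)`. -/
noncomputable def zterm (α : List ℕ) (ks : Fin α.length → ℕ) (v : Fin α.sum → ℕ) : ℝ :=
  if Cond α v then ∏ j : Fin α.sum, (1 : ℝ) / (v j : ℝ) ^ ((blockList α ks).getD (j : ℕ) 1) else 0

lemma zetaIdx_eq (α : List ℕ) (ks : Fin α.length → ℕ) :
    zetaIdx α (blockList α ks) = ∑' v, zterm α ks v := by
  unfold zetaIdx
  apply tsum_congr
  intro v
  unfold zterm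
  by_cases hv : Cond α v
  · rw [if_pos hv]; exact if_pos hv
  · rw [if_neg hv]; exact if_neg hv

lemma hasSum_of_eq {ι : Type*} {f g : ι → ℂ} {a b : ℂ} (h : HasSum f a)
    (hf : ∀ x, g x = f x) (ha : b = a) : HasSum g b := by
  rw [ha, funext hf]; exact h

lemma zterm_eq (α : List ℕ) (hα : ∀ a ∈ α, 1 ≤ a) (ks : Fin α.length → ℕ) (v : Fin α.sum → ℕ)
    (hv : Cond α v) :
    zterm α ks v = (∏ j, (1 : ℝ) / v j) *
      ∏ i : Fin α.length, ((1 : ℝ) / v ⟨bst α i, bst_lt α hα i.2⟩) ^ ks i := by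
  have key := prod_starts α hα
    (fun j => ((1 : ℝ) / v j) ^ ((blockList α ks).getD (j : ℕ) 1 - 1)) (by
      intro j hj
      rw [blockList_not_bst α hα ks j hj]; simp)
  simp only [blockList_bst α hα ks, Nat.add_sub_cancel] at key
  rw [← key, zterm, if_pos hv, ← Finset.prod_mul_distrib]
  apply Finset.prod_congr rfl
  intro j _
  have h1 : 1 ≤ (blockList α ks).getD (j : ℕ) 1 := by
    by_cases h : ∀ i < α.length, bst α i ≠ j
    · rw [blockList_not_bst α hα ks j h]
    · push Not at h
      obtain ⟨i, hi, h⟩ := h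
      have := blockList_bst α hα ks ⟨i, hi⟩
      simp only [h] at this
      omega
  rw [← pow_succ', Nat.sub_add_cancel h1, one_div_pow]

lemma cond_le (α : List ℕ) (v : Fin α.sum → ℕ) (hv : Cond α v) (h0 : 0 < α.sum)
    (j : Fin α.sum) : v j ≤ v ⟨0, h0⟩ := by
  obtain ⟨j, hj⟩ := j
  induction j with
  | zero => exact le_rfl
  | succ j ih =>
    refine le_trans ?_ (ih (by omega))
    have := hv.2 ⟨j, by omega⟩ ⟨j + 1, hj⟩ rfl
    split_ifs at this
    · exact this
    · exact this.le

open Classical in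
lemma summable_major (α : List ℕ) (h0 : 0 < α.sum) :
    Summable fun v : Fin α.sum → ℕ =>
      if Cond α v then ((1 : ℝ) / v ⟨0, h0⟩) * ∏ j, (1 : ℝ) / v j else 0 := by
  set p := α.sum with hp
  have hp0 : (0 : ℝ) < (p : ℝ)⁻¹ := by positivity
  have hs : Summable fun k : ℕ => ((1 : ℝ) / k) ^ ((p : ℝ)⁻¹) * (1 / k) := by
    have := (Real.summable_one_div_nat_rpow (p := (p : ℝ)⁻¹ + 1)).2 (by linarith)
    refine this.congr ?_
    intro k
    rcases Nat.eq_zero_or_pos k with rfl | hk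
    · simp [Real.zero_rpow (show (p : ℝ)⁻¹ + 1 ≠ 0 by linarith)]
    · have hk' : (0 : ℝ) < k := by exact_mod_cast hk
      rw [Real.rpow_add hk', Real.rpow_one, Real.div_rpow (by norm_num) hk'.le, Real.one_rpow]
      field_simp
  have hs' : Summable fun k : ℕ => ‖((1 : ℝ) / k) ^ ((p : ℝ)⁻¹) * (1 / k)‖ := hs.norm
  have := (pi_hasSum p (fun _ k => ((1 : ℝ) / k) ^ ((p : ℝ)⁻¹) * (1 / k)) (fun _ => hs')).1
  refine Summable.of_nonneg_of_le ?_ ?_ this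
  · intro v
    split_ifs <;> positivity
  · intro v
    split_ifs with hv
    · refine le_trans ?_ (le_abs_self _)
      rw [Finset.prod_mul_distrib]
      apply mul_le_mul_of_nonneg_right _ (by positivity)
      have e : ((1 : ℝ) / v ⟨0, h0⟩) = ∏ _j : Fin p, ((1 : ℝ) / v ⟨0, h0⟩) ^ ((p : ℝ)⁻¹) := by
        rw [Finset.prod_const, Finset.card_univ, Fintype.card_fin,
          Real.rpow_inv_natCast_pow (by positivity) (by omega)]
      rw [e]
      apply Finset.prod_le_prod
      · intros; positivity
      · intro j _
        apply Real.rpow_le_rpow (by positivity) _ hp0.le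
        have h1 : (0 : ℝ) < v j := by exact_mod_cast hv.1 j
        have h2 : (v j : ℝ) ≤ v ⟨0, h0⟩ := by exact_mod_cast cond_le α v hv h0 j
        exact one_div_le_one_div_of_le h1 h2
    · positivity

/-- The coefficient attached to a tuple `ks`. -/
noncomputable def Acoef (s : ℕ) (hs : 0 < s) (z : ℂ) (ks : Fin s → ℕ) : ℂ :=
  if 1 ≤ ks ⟨0, hs⟩ then -(-z) ^ (∑ i, ks i) else 0

lemma Acoef_eq (s : ℕ) (hs : 0 < s) (z : ℂ) (ks : Fin s → ℕ) :
    Acoef s hs z ks = ∏ i, ((if i = ⟨0, hs⟩ then (if 1 ≤ ks i then -1 else 0) else 1)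
      * (-z) ^ ks i) := by
  rw [Finset.prod_mul_distrib, Finset.prod_ite_eq', Finset.prod_pow_eq_pow_sum]
  simp [Acoef]

lemma summable_F (α : List ℕ) (hα : ∀ a ∈ α, 1 ≤ a) (hlen : 0 < α.length) (h0 : 0 < α.sum)
    (z : ℂ) (hz : ‖z‖ < 1) :
    Summable fun x : (Fin α.sum → ℕ) × (Fin α.length → ℕ) =>
      Acoef α.length hlen z x.2 * (zterm α x.2 x.1 : ℂ) := by
  classical
  have h1 := summable_major α h0
  have h2 := (pi_hasSum α.length (fun _ k => ‖z‖ ^ k) (fun _ => by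
    simpa using summable_geometric_of_lt_one (norm_nonneg z) hz)).1
  have h3 := h1.mul_of_nonneg h2 (by intro v; dsimp only [Pi.zero_apply]; split_ifs <;> positivity)
    (by intro v; dsimp only [Pi.zero_apply]; positivity)
  refine Summable.of_norm_bounded h3 ?_
  rintro ⟨v, ks⟩
  simp only
  by_cases hv : Cond α v
  swap
  · simp [zterm, hv]
  rw [if_pos hv, zterm_eq α hα ks v hv, Acoef]
  split_ifs with hk
  swap
  · simp; positivity
  have hle : ∏ i : Fin α.length, ((1 : ℝ) / v ⟨bst α i, bst_lt α hα i.2⟩) ^ ks i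
      ≤ (1 : ℝ) / v ⟨0, h0⟩ := by
    have e : (1 : ℝ) / v ⟨0, h0⟩ = ∏ i : Fin α.length,
        if i = ⟨0, hlen⟩ then (1 : ℝ) / v ⟨bst α i, bst_lt α hα i.2⟩ else 1 := by
      rw [Finset.prod_ite_eq']
      simp [bst]
    rw [e]
    apply Finset.prod_le_prod
    · intros; positivity
    · intro i _
      have hw : (1 : ℝ) ≤ v ⟨bst α i, bst_lt α hα i.2⟩ := by exact_mod_cast hv.1 _
      have hw1 : (1 : ℝ) / v ⟨bst α i, bst_lt α hα i.2⟩ ≤ 1 := by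
        rw [div_le_one (by linarith)]; exact hw
      split_ifs with hi
      · subst hi
        exact pow_le_of_le_one (by positivity) hw1 (by omega)
      · exact pow_le_one₀ (by positivity) hw1
  have hn : ‖∏ i, ‖z‖ ^ ks i‖ = ‖z‖ ^ ∑ i, ks i := by
    rw [Finset.prod_pow_eq_pow_sum]; simp
  rw [hn, norm_mul, norm_neg, norm_pow, norm_neg, Complex.norm_real, Real.norm_of_nonneg (by positivity),
    mul_comm]
  apply mul_le_mul_of_nonneg_right _ (by positivity)
  rw [mul_comm]
  exact mul_le_mul_of_nonneg_right hle (by positivity)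

lemma hasSum_F (α : List ℕ) (hα : ∀ a ∈ α, 1 ≤ a) (hlen : 0 < α.length)
    (z : ℂ) (hz : ‖z‖ < 1) (v : Fin α.sum → ℕ) :
    HasSum (fun ks => Acoef α.length hlen z ks * (zterm α ks v : ℂ)) (Gterm α z v) := by
  classical
  by_cases hv : Cond α v
  swap
  · have : Gterm α z v = 0 := if_neg hv
    rw [this]
    simp [zterm, hv]
  set w : Fin α.length → ℂ := fun i => (v ⟨bst α i, bst_lt α hα i.2⟩ : ℂ) with hw
  have hwn : ∀ i, 1 ≤ ‖w i‖ := by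
    intro i
    simp only [hw, Complex.norm_natCast]
    exact_mod_cast hv.1 _
  have hw0 : ∀ i, w i ≠ 0 := by
    intro i h
    have := hwn i
    rw [h] at this; simp at this; linarith
  have hq : ∀ i, ‖-z / w i‖ < 1 := by
    intro i
    rw [norm_div, norm_neg, div_lt_one (by linarith [hwn i])]
    linarith [hwn i]
  have hwz : ∀ i, w i + z ≠ 0 := by
    intro i h
    have h1 : z = - w i := by linear_combination h
    have := hwn i
    rw [h1, norm_neg] at hz
    linarith
  set φ : Fin α.length → ℕ → ℂ := fun i k =>
    (if i = ⟨0, hlen⟩ then (if 1 ≤ k then -1 else 0) else 1) * (-z / w i) ^ k with hφ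
  have hgeo : ∀ i, HasSum (fun k : ℕ => (-z / w i) ^ k) (w i / (w i + z)) := by
    intro i
    have := hasSum_geometric_of_norm_lt_one (hq i)
    refine hasSum_of_eq this (fun _ => rfl) ?_
    have h1 := hw0 i
    have h2 := hwz i
    have h3 : 1 - -z / w i = (w i + z) / w i := by field_simp; ring
    rw [h3, inv_div]
  have hφs : ∀ i, Summable fun k => ‖φ i k‖ := by
    intro i
    refine Summable.of_nonneg_of_le (fun _ => norm_nonneg _) ?_
      (summable_geometric_of_lt_one (norm_nonneg _) (hq i))
    intro k
    simp only [hφ, norm_mul, norm_pow]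
    apply mul_le_of_le_one_left (by positivity)
    split_ifs <;> simp
  have hφt : ∀ i, ∑' k, φ i k = if i = ⟨0, hlen⟩ then 1 - w i / (w i + z) else w i / (w i + z) := by
    intro i
    apply HasSum.tsum_eq
    split_ifs with hi
    · have h1 : HasSum (fun k : ℕ => if k = 0 then (1 : ℂ) else 0) 1 := hasSum_ite_eq 0 1
      refine hasSum_of_eq (h1.sub (hgeo i)) ?_ rfl
      intro k
      simp only [hφ, if_pos hi]
      rcases Nat.eq_zero_or_pos k with rfl | hk
      · simp
      · rw [if_pos (by omega), if_neg (by omega)]; ring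
    · refine hasSum_of_eq (hgeo i) ?_ rfl
      intro k
      simp [hφ, hi]
  have hmain := ((pi_hasSum α.length φ hφs).2).mul_left (∏ j, (1 : ℂ) / v j)
  refine hasSum_of_eq hmain ?_ ?_
  · intro ks
    rw [zterm_eq α hα ks v hv, Acoef_eq]
    push_cast
    rw [mul_left_comm, ← Finset.prod_mul_distrib]
    congr 1
    apply Finset.prod_congr rfl
    intro i _
    simp only [hφ, hw]
    rw [mul_assoc, ← mul_pow]
    congr 2
    ring
  · simp only [hφt]
    have e : Gterm α z v = ∏ j : Fin α.sum, (if (j : ℕ) = 0 then (1 / (v j : ℂ) - 1 / ((v j : ℂ) + z))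
             else if (j : ℕ) ∈ boundarySet α then 1 / ((v j : ℂ) + z)
             else 1 / (v j : ℂ)) := if_pos hv
    have key := prod_starts α hα (fun j => if (j : ℕ) = 0 then 1 - (v j : ℂ) / ((v j : ℂ) + z)
             else if (j : ℕ) ∈ boundarySet α then (v j : ℂ) / ((v j : ℂ) + z) else 1) (by
        intro j hj
        have h0 : (j : ℕ) ≠ 0 := fun h => hj 0 hlen (by simp [bst, h])
        have h1 : (j : ℕ) ∉ boundarySet α := by
          rw [mem_boundarySet_iff]
          rintro ⟨i, _, hi, h⟩
          exact hj i hi h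
        simp [h0, h1])
    have e2 : (∏ i : Fin α.length, if i = ⟨0, hlen⟩ then 1 - w i / (w i + z) else w i / (w i + z)) =
        ∏ j : Fin α.sum, (if (j : ℕ) = 0 then 1 - (v j : ℂ) / ((v j : ℂ) + z)
             else if (j : ℕ) ∈ boundarySet α then (v j : ℂ) / ((v j : ℂ) + z) else 1) := by
      rw [key]
      apply Finset.prod_congr rfl
      intro i _
      by_cases hi : i = ⟨0, hlen⟩
      · subst hi
        simp [bst, hw]
      · have hi0 : 0 < (i : ℕ) := by
          rcases Nat.eq_zero_or_pos (i : ℕ) with h | h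
          · exact absurd (Fin.ext h) hi
          · exact h
        have hb : bst α i ∈ boundarySet α := (mem_boundarySet_iff _ _).2 ⟨i, hi0, i.2, rfl⟩
        have hb0 : bst α i ≠ 0 := by
          have := bst_strict α hα hi0 hlen
          omega
        simp [hi, hb, hb0, hw]
    rw [e2, e, ← Finset.prod_mul_distrib]
    apply Finset.prod_congr rfl
    intro j _
    have hj : (v j : ℂ) ≠ 0 := by
      have := hv.1 j
      exact_mod_cast this.ne'
    split_ifs
    · field_simp
    · field_simp
    · simp

lemma hasSum_G (α : List ℕ) (hα : ∀ a ∈ α, 1 ≤ a) (hlen : 0 < α.length) (h0 : 0 < α.sum)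
    (z : ℂ) (hz : ‖z‖ < 1) :
    HasSum (fun k : ℕ => z ^ k * (-(-1 : ℂ) ^ k *
          ((∑ ks ∈ (Finset.Nat.antidiagonalTuple α.length k).filter
                (fun ks => 1 ≤ ks ⟨0, hlen⟩),
              zetaIdx α (blockList α ks) : ℝ) : ℂ))) (Gfun α z) := by
  have hF := summable_F α hα hlen h0 z hz
  have hG : Gfun α z = ∑' x : (Fin α.sum → ℕ) × (Fin α.length → ℕ),
      Acoef α.length hlen z x.2 * (zterm α x.2 x.1 : ℂ) := by
    rw [hF.tsum_prod]
    exact tsum_congr fun v => (hasSum_F α hα hlen z hz v).tsum_eq.symm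
  have hs : HasSum (fun ks => Acoef α.length hlen z ks * (zetaIdx α (blockList α ks) : ℂ))
      (Gfun α z) := by
    have h1 := hF.prod_symm
    have h2 : HasSum _ _ := h1.prod.hasSum
    rw [← h1.tsum_prod] at h2
    have h3 : (∑' p : (Fin α.length → ℕ) × (Fin α.sum → ℕ),
      Acoef α.length hlen z p.swap.2 * (zterm α p.swap.2 p.swap.1 : ℂ)) = Gfun α z := by
      rw [hG]
      exact (Equiv.prodComm (Fin α.length → ℕ) (Fin α.sum → ℕ)).tsum_eq
        (fun x => Acoef α.length hlen z x.2 * (zterm α x.2 x.1 : ℂ))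
    rw [h3] at h2
    refine hasSum_of_eq h2 ?_ rfl
    intro ks
    simp only [Prod.swap_prod_mk]
    rw [tsum_mul_left, zetaIdx_eq, Complex.ofReal_tsum]
  rw [← (Finset.Nat.sigmaAntidiagonalTupleEquivTuple α.length).hasSum_iff] at hs
  have h4 := hs.sigma (g := fun k => ∑ ks ∈ Finset.Nat.antidiagonalTuple α.length k,
    Acoef α.length hlen z ks * (zetaIdx α (blockList α ks) : ℂ)) (fun k => by
      rw [← Finset.sum_coe_sort]
      exact hasSum_fintype _)
  refine hasSum_of_eq h4 ?_ rfl
  intro k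
  push_cast
  rw [Finset.sum_filter, Finset.mul_sum, Finset.mul_sum]
  apply Finset.sum_congr rfl
  intro ks hks
  rw [Finset.Nat.mem_antidiagonalTuple] at hks
  rw [Acoef, hks]
  split_ifs
  · rw [neg_pow z]; ring
  · simp

/-- For any multi-index `α = (α₁,…,α_s)` and `k ≥ 1`, `G_α` is
holomorphic at `0` and `G_α^{(k)}(0)/k!` equals `(-1)^{k-1}` times the sum of
`ζ_α(k₁+1,1,…,1,…,k_s+1,1,…,1)` over all `k₁+⋯+k_s = k` with `k₁ ≥ 1`,
`k₂,…,k_s ≥ 0`, the `i`-th block having length `α_i`. -/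
theorem Gfun_deriv_at_zero (α : List ℕ) (hα : MIdx α) (hlen : 0 < α.length)
    (k : ℕ) (hk : 1 ≤ k) :
    AnalyticAt ℂ (Gfun α) 0 ∧
      iteratedDeriv k (Gfun α) 0 / (k.factorial : ℂ) =
        (-1 : ℂ) ^ (k - 1) *
          ((∑ ks ∈ (Finset.Nat.antidiagonalTuple α.length k).filter
                (fun ks => 1 ≤ ks ⟨0, hlen⟩),
              zetaIdx α (blockList α ks) : ℝ) : ℂ) := by
  have h0 : 0 < α.sum := lt_of_le_of_lt (Nat.zero_le _) (bst_lt α hα.2 hlen)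
  set c : ℕ → ℂ := fun k => -(-1 : ℂ) ^ k *
          ((∑ ks ∈ (Finset.Nat.antidiagonalTuple α.length k).filter
                (fun ks => 1 ≤ ks ⟨0, hlen⟩),
              zetaIdx α (blockList α ks) : ℝ) : ℂ) with hc
  have hps : HasFPowerSeriesAt (Gfun α) (FormalMultilinearSeries.ofScalars ℂ c) 0 := by
    rw [hasFPowerSeriesAt_iff]
    filter_upwards [Metric.ball_mem_nhds (0 : ℂ) one_pos] with z hz
    rw [mem_ball_zero_iff] at hz
    simpa [FormalMultilinearSeries.coeff_ofScalars, hc] using hasSum_G α hα.2 hlen h0 z hz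
  refine ⟨hps.analyticAt, ?_⟩
  obtain ⟨r, hr⟩ := hps
  have h1 := hr.factorial_smul (1 : ℂ) k
  rw [iteratedDeriv_eq_iteratedFDeriv, ← h1]
  have hk0 : (k.factorial : ℂ) ≠ 0 := by exact_mod_cast k.factorial_ne_zero
  rw [nsmul_eq_mul, mul_div_cancel_left₀ _ hk0]
  have h2 : (FormalMultilinearSeries.ofScalars ℂ c k) (fun _ => (1 : ℂ)) = c k := by
    simp
  rw [h2]
  simp only [hc]
  obtain ⟨m, rfl⟩ : ∃ m, k = m + 1 := ⟨k - 1, by omega⟩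
  simp only [Nat.add_sub_cancel]
  rw [pow_succ]
  ring
end

section
/- For every multi-index α = (α_1,…,α_s), ζ_α(2,1,…,1), where the argument has |α| entries, equals ζ^+( d(α^τ) ). -/
open scoped BigOperators

namespace DT
open scoped ENNReal
open Finset

/-- weight -/
noncomputable def w (n e : ℕ) : ℝ≥0∞ := if 0 < n then ENNReal.ofReal (1 / (n : ℝ) ^ e) else 0

def cmp (b : Bool) (m n : ℕ) : Prop := if b = true then m ≤ n else m < n

instance (b : Bool) (m n : ℕ) : Decidable (cmp b m n) := by unfold cmp; infer_instance

noncomputable def S : List (Bool × ℕ) → ℕ → ℝ≥0∞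
  | [], _ => 1
  | p :: t, B => ∑' n : ℕ, (if cmp p.1 n B then w n p.2 * S t n else 0)

lemma w_add (n a b : ℕ) : w n (a + b) = w n a * w n b := by
  unfold w
  split_ifs
  · rw [← ENNReal.ofReal_mul (by positivity), pow_add]
    congr 1
    rw [one_div_mul_one_div]
  · simp

lemma w_mono {n a b : ℕ} (h : a ≤ b) : w n b ≤ w n a := by
  unfold w
  split_ifs with hn
  · apply ENNReal.ofReal_le_ofReal
    apply one_div_le_one_div_of_le (by positivity)
    exact pow_le_pow_right₀ (by exact_mod_cast hn) h
  · simp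

noncomputable def c (n a : ℕ) : ℝ := (((n + a).choose n : ℕ) : ℝ)⁻¹

lemma c_nonneg (n a : ℕ) : 0 ≤ c n a := by unfold c; positivity

lemma c_symm (n a : ℕ) : c n a = c a n := by
  unfold c
  rw [Nat.choose_symm_add, add_comm a n]

lemma c_zero (a : ℕ) : c 0 a = 1 := by simp [c]

lemma ch_ne (n a : ℕ) : (((n + a).choose n : ℕ) : ℝ) ≠ 0 := by
  have := Nat.choose_pos (n := n + a) (k := n) (by omega)
  positivity

lemma c_tel (n a : ℕ) (ha : 0 < a) :
    1 / ((n + 1 : ℕ) : ℝ) ^ 1 * c (n + 1) a = (c n a - c (n + 1) a) / a := by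
  have h := Nat.add_one_mul_choose_eq (n + a) n
  have h2 : n + 1 + a = n + a + 1 := by omega
  have hX := ch_ne n a
  have hY := ch_ne (n + 1) a
  unfold c
  rw [h2] at hY ⊢
  generalize (n + a).choose n = X at *
  generalize (n + a + 1).choose (n + 1) = Y at *
  have hxy : ((n : ℝ) + a + 1) * X = Y * (n + 1) := by exact_mod_cast h
  have : (a : ℝ) ≠ 0 := by positivity
  push_cast
  field_simp
  linear_combination hxy

lemma c_le (n a : ℕ) (ha : 0 < a) : c n a ≤ 1 / ((n : ℝ) + 1) := by
  unfold c
  rw [one_div]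
  apply inv_anti₀ (by positivity)
  have := Nat.choose_le_choose n (show n + 1 ≤ n + a by omega)
  rw [Nat.choose_succ_self_right] at this
  exact_mod_cast this

lemma c_tendsto (a : ℕ) (ha : 0 < a) : Filter.Tendsto (fun n => c n a) Filter.atTop (nhds 0) :=
  squeeze_zero (fun n => c_nonneg n a) (fun n => c_le n a ha) tendsto_one_div_add_atTop_nhds_zero_nat

lemma c_hasSum (m a : ℕ) (ha : 0 < a) :
    HasSum (fun n : ℕ => if m < n then 1 / (n : ℝ) ^ 1 * c n a else 0) (1 / (a : ℝ) ^ 1 * c m a) := by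
  rw [hasSum_iff_tendsto_nat_of_nonneg]
  · rw [← Filter.tendsto_add_atTop_iff_nat (m + 1)]
    have : ∀ k, ∑ n ∈ range (k + (m + 1)), (if m < n then 1 / (n : ℝ) ^ 1 * c n a else 0)
        = (c m a - c (k + m) a) / a := by
      intro k
      induction k with
      | zero =>
        simp only [zero_add, sub_self, zero_div]
        apply sum_eq_zero
        intro x hx
        rw [mem_range] at hx
        rw [if_neg (by omega)]
      | succ k ih =>
        rw [show k + 1 + (m + 1) = k + (m + 1) + 1 by omega, sum_range_succ, ih, if_pos (by omega)]
        have := c_tel (k + m) a ha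
        rw [show k + (m + 1) = k + m + 1 by omega, this, show k + 1 + m = k + m + 1 by omega]
        ring
    simp only [this]
    have h := ((c_tendsto a ha).comp (Filter.tendsto_add_atTop_nat m)).const_sub (c m a)
    have h := h.div_const (a : ℝ)
    convert h using 2
    simp; ring
  · intro n
    have := c_nonneg n a
    split_ifs <;> positivity

noncomputable def C (n a : ℕ) : ℝ≥0∞ := ENNReal.ofReal (c n a)

lemma C_strict (m a : ℕ) (ha : 0 < a) :
    ∑' n : ℕ, (if m < n then w n 1 * C n a else 0) = w a 1 * C m a := by
  have h := c_hasSum m a ha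
  have h0 : ∀ n : ℕ, 0 ≤ (if m < n then 1 / (n : ℝ) ^ 1 * c n a else 0) := by
    intro n
    have := c_nonneg n a
    split_ifs <;> positivity
  have := ENNReal.ofReal_tsum_of_nonneg h0 h.summable
  rw [h.tsum_eq, ENNReal.ofReal_mul (by positivity)] at this
  unfold C
  rw [w, if_pos ha, this]
  congr 1
  ext n
  split_ifs with hn
  · rw [w, if_pos (by omega), ENNReal.ofReal_mul (by positivity)]
  · simp

lemma C_weak (m a : ℕ) (hm : 0 < m) (ha : 0 < a) :
    ∑' n : ℕ, (if m ≤ n then w n 1 * C n a else 0) =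
    ∑' b : ℕ, (if a ≤ b then w b 1 * C m b else 0) := by
  obtain ⟨m, rfl⟩ := Nat.exists_eq_succ_of_ne_zero hm.ne'
  obtain ⟨a, rfl⟩ := Nat.exists_eq_succ_of_ne_zero ha.ne'
  have h1 := C_strict m (a + 1) (by omega)
  have h2 := C_strict a (m + 1) (by omega)
  have h3 : ∀ b, C b (m + 1) = C (m + 1) b := fun b => by unfold C; rw [c_symm]
  simp only [Nat.succ_le_iff, Nat.succ_eq_add_one, h3] at h2 ⊢
  simp only [Nat.lt_iff_add_one_le] at *
  rw [h1, h2, ← h3]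
  unfold C w
  rw [if_pos (by omega), if_pos (by omega), ← ENNReal.ofReal_mul (by positivity),
    ← ENNReal.ofReal_mul (by positivity)]
  congr 1
  have e1 := Nat.choose_succ_right_eq (m + (a + 1)) m
  have e2 : (a + (m + 1)).choose a = (m + (a + 1)).choose (m + 1) := by
    rw [Nat.choose_symm_add]; congr 1; omega
  rw [show m + (a + 1) - m = a + 1 by omega] at e1
  have hX := ch_ne m (a + 1)
  have hY := ch_ne a (m + 1)
  unfold c
  rw [e2] at hY ⊢
  generalize (m + (a + 1)).choose m = X at *
  generalize (m + (a + 1)).choose (m + 1) = Y at *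
  have hxy : (Y : ℝ) * (m + 1) = X * (a + 1) := by exact_mod_cast e1
  push_cast
  field_simp
  linear_combination hxy

/-- connected sum -/
noncomputable def T (t : List Bool) (a : ℕ) : ℝ≥0∞ :=
  ∑' n : ℕ, w n 1 * C n a * S (t.map fun b => (b, 1)) n

lemma w_zero (e : ℕ) : w 0 e = 0 := by simp [w]

lemma T_nil (a : ℕ) (ha : 0 < a) : T [] a = w a 1 := by
  have := C_strict 0 a ha
  rw [show C 0 a = 1 by simp [C, c_zero], mul_one] at this
  rw [← this]
  unfold T
  congr 1
  ext n
  rcases Nat.eq_zero_or_pos n with rfl | hn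
  · simp [w_zero]
  · simp [S, hn]

lemma T_false (t : List Bool) (a : ℕ) (ha : 0 < a) : T (false :: t) a = w a 1 * T t a := by
  unfold T
  simp only [List.map_cons, S, cmp, ← ENNReal.tsum_mul_left]
  rw [ENNReal.tsum_comm]
  congr 1
  ext m
  have : ∀ n, w n 1 * C n a * (if (if false = true then m ≤ n else m < n) then w m 1 * S (t.map fun b => (b, 1)) m else 0)
      = (if m < n then w n 1 * C n a else 0) * (w m 1 * S (t.map fun b => (b, 1)) m) := by
    intro n
    simp
  simp only [this]
  rw [ENNReal.tsum_mul_right, C_strict m a ha]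
  ring

lemma T_true (t : List Bool) (a : ℕ) (ha : 0 < a) :
    T (true :: t) a = ∑' b : ℕ, (if a ≤ b then w b 1 * T t b else 0) := by
  have hR : ∀ b, (if a ≤ b then w b 1 * T t b else 0) =
      ∑' m : ℕ, (if a ≤ b then w b 1 * C m b else 0) * (w m 1 * S (t.map fun b => (b, 1)) m) := by
    intro b
    unfold T
    split_ifs
    · rw [← ENNReal.tsum_mul_left]
      congr 1; ext m; ring
    · simp
  simp only [hR]
  rw [ENNReal.tsum_comm]
  unfold T
  simp only [List.map_cons, S, cmp, ← ENNReal.tsum_mul_left]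
  rw [ENNReal.tsum_comm]
  congr 1
  ext m
  trans ∑' n : ℕ, (if m ≤ n then w n 1 * C n a else 0) * (w m 1 * S (t.map fun b => (b, 1)) m)
  · apply tsum_congr
    intro n
    by_cases h : m ≤ n <;> simp [h]
  rw [ENNReal.tsum_mul_right, ENNReal.tsum_mul_right]
  rcases Nat.eq_zero_or_pos m with rfl | hm
  · simp [w_zero]
  · rw [C_weak m a hm ha]

lemma start (t : List Bool) :
    ∑' n : ℕ, w n 2 * S (t.map fun b => (b, 1)) n = ∑' a : ℕ, w a 1 * T t a := by
  unfold T
  simp only [← ENNReal.tsum_mul_left]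
  rw [ENNReal.tsum_comm]
  congr 1
  ext n
  rcases Nat.eq_zero_or_pos n with rfl | hn
  · simp [w_zero]
  have h := C_strict 0 n hn
  rw [show C 0 n = 1 by simp [C, c_zero], mul_one] at h
  have : ∀ a, w a 1 * (w n 1 * C n a * S (t.map fun b => (b, 1)) n) =
     (if 0 < a then w a 1 * C a n else 0) * (w n 1 * S (t.map fun b => (b, 1)) n) := by
    intro a
    rcases Nat.eq_zero_or_pos a with rfl | ha
    · simp [w_zero]
    · rw [if_pos ha, show C a n = C n a by unfold C; rw [c_symm]]; ring
  simp only [this]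
  rw [ENNReal.tsum_mul_right, h, show 2 = 1 + 1 from rfl, w_add]
  ring

/-- flags, including the leading weak comparison -/
def flags : List ℕ → List Bool
  | [] => []
  | a :: t => true :: (List.replicate (a - 1) false ++ flags t)

lemma T_rep (k : ℕ) (t : List Bool) (x : ℕ) (hx : 0 < x) :
    T (List.replicate k false ++ t) x = w x k * T t x := by
  induction k with
  | zero => simp [w, hx]
  | succ k ih =>
    rw [List.replicate_succ, List.cons_append, T_false _ _ hx, ih, add_comm k 1, w_add]; ring

lemma T_flags (a : ℕ) (ha : 1 ≤ a) (t : List ℕ) (x : ℕ) (hx : 0 < x) :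
    T (flags (a :: t)) x = ∑' b : ℕ, (if x ≤ b then w b a * T (flags t) b else 0) := by
  rw [flags, T_true _ _ hx]
  congr 1
  ext b
  split_ifs with h
  · rw [T_rep _ _ _ (by omega), ← mul_assoc, ← w_add, show 1 + (a - 1) = a by omega]
  · rfl

noncomputable def F : List ℕ → ℝ≥0∞
  | [] => 0
  | h :: r => ∑' n : ℕ, w n 1 * w n h * S (r.map fun e => (true, e)) n

lemma rev (t : List ℕ) (ht : ∀ a ∈ t, 1 ≤ a) (a : ℕ) (u : List ℕ) :
    ∑' x : ℕ, w x a * S (u.map fun e => (true, e)) x * T (flags t) x = F (t.reverse ++ a :: u) := by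
  induction t generalizing a u with
  | nil =>
    simp only [List.reverse_nil, List.nil_append, F, flags]
    congr 1
    ext x
    rcases Nat.eq_zero_or_pos x with rfl | hx
    · simp [w_zero]
    · rw [T_nil _ hx]; ring
  | cons a' t ih =>
    rw [List.reverse_cons, List.append_assoc, List.singleton_append,
      ← ih (fun y hy => ht y (by simp [hy]))]
    have : ∀ x, w x a * S (u.map fun e => (true, e)) x * T (flags (a' :: t)) x =
      ∑' b : ℕ, (if x ≤ b then w x a * S (u.map fun e => (true, e)) x else 0) *
        (w b a' * T (flags t) b) := by
      intro x
      rcases Nat.eq_zero_or_pos x with rfl | hx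
      · simp [w_zero]
      · rw [T_flags a' (ht _ (by simp)) t x hx, ← ENNReal.tsum_mul_left]
        congr 1; ext b; split_ifs <;> simp
    simp only [this]
    rw [ENNReal.tsum_comm]
    congr 1
    ext b
    rw [ENNReal.tsum_mul_right]
    simp only [List.map_cons, S, cmp, if_true]
    ring

/-- Main identity in `ℝ≥0∞`. -/
lemma main (a : ℕ) (t : List ℕ) (h : ∀ x ∈ a :: t, 1 ≤ x) :
    ∑' n : ℕ, w n 2 * S ((List.replicate (a - 1) false ++ flags t).map fun b => (b, 1)) n
      = F (a :: t).reverse := by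
  rw [start, List.reverse_cons, ← rev t (fun y hy => h y (by simp [hy]))]
  congr 1
  ext x
  rcases Nat.eq_zero_or_pos x with rfl | hx
  · simp [w_zero]
  · have := h a (by simp)
    rw [T_rep _ _ _ hx, ← mul_assoc, ← w_add, show 1 + (a - 1) = a by omega]
    simp [S]

noncomputable def G (f : ℕ → ℝ≥0∞) : List ℕ → ℝ≥0∞
  | [] => 0
  | b :: r => ∑' n : ℕ, f n * w n b * S (r.map fun e => (false, e)) n

lemma list_tsum {ι : Type} (l : List ι) (g : ι → ℕ → ℝ≥0∞) :
    (l.map fun i => ∑' n, g i n).sum = ∑' n, (l.map fun i => g i n).sum := by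
  induction l with
  | nil => simp
  | cons i l ih => simp [ih, ENNReal.tsum_add]

lemma splits_ne (a : ℕ) (t : List ℕ) : ∀ c ∈ splits (a :: t), c ≠ [] := by
  intro c hc
  simp only [splits, List.mem_append, List.mem_map, List.mem_filterMap] at hc
  rcases hc with ⟨d, _, rfl⟩ | ⟨d, _, h⟩
  · simp
  · cases d with
    | nil => simp at h
    | cons b r => simp at h; subst h; simp

lemma merge_sum (a : ℕ) (f : ℕ → ℝ≥0∞) (L : List (List (List ℕ))) (hL : ∀ c ∈ L, c ≠ []) :
    ((L.filterMap (fun c =>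
        match c with
        | [] => none
        | b :: r => some ((a :: b) :: r))).map fun c => G f (c.map List.sum)).sum
    = (L.map fun c => G (fun n => f n * w n a) (c.map List.sum)).sum := by
  induction L with
  | nil => simp
  | cons d L ih =>
    cases d with
    | nil => simp at hL
    | cons b r =>
      have := ih (fun c hc => hL c (by simp [hc]))
      simp only [List.filterMap_cons, List.map_cons, List.sum_cons, this]
      congr 1
      simp only [G, w_add, mul_assoc]

lemma S_strict_eq_G (L : List ℕ) (hL : L ≠ []) (n : ℕ) :
    S (L.map fun e => (false, e)) n = G (fun m => if m < n then 1 else 0) L := by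
  cases L with
  | nil => simp at hL
  | cons b r =>
    simp only [List.map_cons, S, G, cmp]
    congr 1; ext m; simp

lemma coarsen (t : List ℕ) : ∀ (a : ℕ) (f : ℕ → ℝ≥0∞),
    ((splits (a :: t)).map fun c => G f (c.map List.sum)).sum
      = ∑' n : ℕ, f n * w n a * S (t.map fun e => (true, e)) n := by
  induction t with
  | nil => intro a f; simp [splits, G, S]
  | cons a' t ih =>
    intro a f
    rw [splits, List.map_append, List.sum_append, merge_sum _ _ _ (splits_ne _ _), ih]
    rw [List.map_map]
    have : (fun c => G f (List.map List.sum c)) ∘ (fun c => [a] :: c) =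
        fun c => ∑' n, f n * w n a * S ((c.map List.sum).map fun e => (false, e)) n := by
      ext c; simp [G]
    rw [this, list_tsum, ← ENNReal.tsum_add]
    congr 1
    ext n
    rw [List.sum_map_mul_left]
    have h2 : ((splits (a' :: t)).map fun c => S ((c.map List.sum).map fun e => (false, e)) n)
       = (splits (a' :: t)).map fun c => G (fun m => if m < n then 1 else 0) (c.map List.sum) := by
      apply List.map_congr_left
      intro c hc
      exact S_strict_eq_G _ (by simpa using splits_ne _ _ c hc) n
    rw [h2, ih, mul_assoc (f n * w n a), ← mul_add]
    congr 1
    simp only [List.map_cons, S, cmp, if_true]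
    have : w n a' * S (t.map fun e => (true, e)) n =
      ∑' m, if m = n then w m a' * S (t.map fun e => (true, e)) m else 0 := by
      rw [tsum_ite_eq n]
    rw [this, ← ENNReal.tsum_add]
    congr 1
    ext m
    rcases lt_trichotomy m n with h | h | h
    · simp [h, h.ne, h.le]
    · simp [h]
    · simp [h.ne', h.not_gt, h.not_ge]

/-- Finiteness. -/
lemma S_mono (r : List ℕ) (hr : ∀ x ∈ r, 1 ≤ x) (B : ℕ) :
    S (r.map fun e => (false, e)) B ≤ S ((List.replicate r.length false).map fun b => (b, 1)) B := by
  induction r generalizing B with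
  | nil => simp [S]
  | cons a r ih =>
    simp only [List.map_cons, List.length_cons, List.replicate_succ, S]
    apply ENNReal.tsum_le_tsum
    intro n
    split_ifs
    · exact mul_le_mul' (w_mono (hr a (by simp))) (ih (fun x hx => hr x (by simp [hx])) n)
    · simp

lemma w_sum (k : ℕ) : ∑' n : ℕ, w n (k + 2) ≠ ⊤ := by
  have h := (Real.summable_one_div_nat_pow (p := k + 2)).2 (by omega)
  have : ∀ n, w n (k + 2) = ENNReal.ofReal (1 / (n : ℝ) ^ (k + 2)) := by
    intro n
    rcases Nat.eq_zero_or_pos n with rfl | hn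
    · simp [w_zero]
    · simp [w, hn]
  simp only [this]
  exact h.tsum_ofReal_ne_top

lemma finite (b : ℕ) (r : List ℕ) (h : ∀ x ∈ b :: r, 1 ≤ x) : G (fun n => w n 1) (b :: r) ≠ ⊤ := by
  have h1 := main (r.length + 1) [] (by simp)
  simp only [List.reverse_singleton, F, List.map_nil, S, mul_one, flags, List.append_nil,
    Nat.add_sub_cancel, ← w_add] at h1
  have h2 := w_sum r.length
  rw [show ∀ n, 1 + (n + 1) = n + 2 by intro n; omega] at h1
  rw [← h1] at h2
  refine ne_top_of_le_ne_top h2 ?_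
  apply ENNReal.tsum_le_tsum
  intro n
  have hb := h b (by simp)
  refine mul_le_mul' ?_ (S_mono r (fun x hx => h x (by simp [hx])) n)
  rw [← w_add]
  exact w_mono (by omega)

/-- Conversion of tuple sums. -/
def Ch (N : ℕ) (W : ℕ → Bool) (v : Fin N → ℕ) : Prop :=
  ∀ j k : Fin N, (k : ℕ) = (j : ℕ) + 1 → cmp (W k) (v k) (v j)

lemma Ch_cons (N : ℕ) (W : ℕ → Bool) (n : ℕ) (u : Fin N → ℕ) :
    Ch (N + 1) W (Fin.cons n u) ↔ Ch N (fun i => W (i + 1)) u ∧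
      ∀ j : Fin N, (j : ℕ) = 0 → cmp (W 1) (u j) n := by
  constructor
  · intro h
    refine ⟨fun j k hjk => ?_, fun j hj => ?_⟩
    · have := h j.succ k.succ (by simp [hjk])
      simpa using this
    · have := h 0 j.succ (by simp [hj])
      simpa [hj] using this
  · rintro ⟨h1, h2⟩ j k hjk
    cases k using Fin.cases with
    | zero => simp at hjk
    | succ k =>
      cases j using Fin.cases with
      | zero =>
        have hk : (k : ℕ) = 0 := by simpa using hjk
        simpa [hk] using h2 k hk
      | succ j =>
        simpa using h1 j k (by simpa using hjk)

lemma tsum_cons (N : ℕ) (f : (Fin (N + 1) → ℕ) → ℝ≥0∞) :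
    ∑' v, f v = ∑' n : ℕ, ∑' u : Fin N → ℕ, f (Fin.cons n u) := by
  rw [← (Fin.consEquiv (fun _ : Fin (N + 1) => ℕ)).tsum_eq, ENNReal.tsum_prod']
  rfl

open Classical in
lemma chain (N : ℕ) : ∀ (W : ℕ → Bool) (e : ℕ → ℕ) (B : ℕ),
    (∑' v : Fin N → ℕ, if Ch N W v ∧ ∀ j : Fin N, (j : ℕ) = 0 → cmp (W 0) (v j) B then
      ∏ j : Fin N, w (v j) (e j) else 0) = S (List.ofFn fun i : Fin N => (W i, e i)) B := by
  induction N with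
  | zero =>
    intro W e B
    simp [S, Ch]
  | succ N ih =>
    intro W e B
    rw [tsum_cons, List.ofFn_succ, S]
    congr 1
    ext n
    have := ih (fun i => W (i + 1)) (fun i => e (i + 1)) n
    simp only [Fin.val_succ]
    rw [← this]
    by_cases hn : cmp (W 0) n B
    · rw [if_pos (show cmp (W ((0 : Fin (N + 1)) : ℕ), e ((0 : Fin (N + 1)) : ℕ)).1 n B from hn), ← ENNReal.tsum_mul_left]
      congr 1
      ext u
      rw [Fin.prod_univ_succ, Ch_cons]
      simp [hn]
    · rw [if_neg (show ¬ cmp (W ((0 : Fin (N + 1)) : ℕ), e ((0 : Fin (N + 1)) : ℕ)).1 n B from hn)]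
      simp only [ENNReal.tsum_eq_zero]
      intro u
      rw [if_neg]
      rintro ⟨_, h⟩
      exact hn (by simpa using h 0 rfl)

lemma conv (P N : ℕ) (hP : P = N + 1) (s : Finset ℕ) [DecidablePred (· ∈ s)] (μ : List ℕ)
    [∀ v : Fin P → ℕ, Decidable ((∀ j, 0 < v j) ∧ (∀ j k : Fin P, (k : ℕ) = (j : ℕ) + 1 →
          (if (k : ℕ) ∈ s then v k ≤ v j else v k < v j)))] :
    (∑' v : Fin P → ℕ,
    if (∀ j, 0 < v j) ∧ (∀ j k : Fin P, (k : ℕ) = (j : ℕ) + 1 →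
          (if (k : ℕ) ∈ s then v k ≤ v j else v k < v j))
    then ∏ j : Fin P, (1 : ℝ) / (v j : ℝ) ^ (μ.getD (j : ℕ) 1)
    else 0) = (∑' n : ℕ, w n (μ.getD 0 1) *
      S (List.ofFn fun i : Fin N => (decide ((i : ℕ) + 1 ∈ s), μ.getD (i + 1) 1)) n).toReal := by
  subst hP
  set g : (Fin (N + 1) → ℕ) → ℝ := fun v => if (∀ j, 0 < v j) ∧ (∀ j k : Fin (N + 1), (k : ℕ) = (j : ℕ) + 1 →
          (if (k : ℕ) ∈ s then v k ≤ v j else v k < v j))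
    then ∏ j : Fin (N + 1), (1 : ℝ) / (v j : ℝ) ^ (μ.getD (j : ℕ) 1)
    else 0 with hg
  have hg0 : ∀ v, 0 ≤ g v := by
    intro v
    rw [hg]
    dsimp only
    split_ifs
    · exact prod_nonneg fun j _ => by positivity
    · rfl
  have h1 : ∑' v, g v = (∑' v, ENNReal.ofReal (g v)).toReal := by
    rw [ENNReal.tsum_toReal_eq (fun v => ENNReal.ofReal_ne_top)]
    congr 1; ext v
    rw [ENNReal.toReal_ofReal (hg0 v)]
  rw [h1]
  congr 1
  classical
  have h2 : ∀ v, ENNReal.ofReal (g v) = if Ch (N + 1) (fun k => decide (k ∈ s)) v then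
      ∏ j : Fin (N + 1), w (v j) (μ.getD (j : ℕ) 1) else 0 := by
    intro v
    rw [hg]
    dsimp only
    have hc : (∀ j k : Fin (N + 1), (k : ℕ) = (j : ℕ) + 1 →
          (if (k : ℕ) ∈ s then v k ≤ v j else v k < v j)) ↔ Ch (N + 1) (fun k => decide (k ∈ s)) v := by
      simp [Ch, cmp]
    by_cases hp : ∀ j, 0 < v j
    · by_cases hq : Ch (N + 1) (fun k => decide (k ∈ s)) v
      · rw [if_pos ⟨hp, hc.2 hq⟩, if_pos hq, ENNReal.ofReal_prod_of_nonneg (fun j _ => by positivity)]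
        refine prod_congr rfl fun j _ => ?_
        rw [w, if_pos (hp j)]
      · rw [if_neg (fun h => hq (hc.1 h.2)), if_neg hq, ENNReal.ofReal_zero]
    · rw [if_neg (fun h => hp h.1), ENNReal.ofReal_zero]
      push Not at hp
      obtain ⟨j, hj⟩ := hp
      rw [Finset.prod_eq_zero (mem_univ j)]
      · simp
      · rw [Nat.le_zero.1 hj, w_zero]
  simp only [h2]
  rw [tsum_cons]
  congr 1
  ext n
  rw [← chain N (fun i => decide (i + 1 ∈ s)) (fun i => μ.getD (i + 1) 1), ← ENNReal.tsum_mul_left]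
  congr 1
  ext u
  rw [Fin.prod_univ_succ, Ch_cons]
  simp

lemma MZV_eq (b : ℕ) (r : List ℕ) : MZV (mplus (b :: r)) = (G (fun n => w n 1) (b :: r)).toReal := by
  unfold MZV zetaIdx mplus
  rw [conv _ r.length (by simp)]
  congr 1
  unfold G
  congr 1
  ext n
  congr 1
  · rw [← w_add, add_comm]; rfl
  · congr 1
    apply List.ext_getElem
    · simp
    · intro i h1 h2
      simp only [List.length_map] at h2
      simp [boundarySet]

lemma bs_cons (a b : ℕ) (t : List ℕ) (i : ℕ) :
    i ∈ boundarySet (a :: b :: t) ↔ i = a ∨ ∃ j ∈ boundarySet (b :: t), i = a + j := by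
  have hs : ∀ (l : List ℕ) (x y : ℕ), List.scanl (· + ·) (x + y) l =
      (List.scanl (· + ·) y l).map (x + ·) := by
    intro l
    induction l with
    | nil => simp
    | cons z l ih => intro x y; simp [List.scanl_cons, ← ih, add_assoc]
  unfold boundarySet
  simp only [List.scanl_cons, List.drop_succ_cons, List.drop_zero, zero_add, List.mem_toFinset]
  rw [hs t a b]
  have hne : List.scanl (· + ·) b t ≠ [] := by simp
  rw [List.dropLast_cons_of_ne_nil (by simp), ← List.map_dropLast, List.mem_cons, List.mem_map]
  simp only [eq_comm]

lemma flags_ext (t : List ℕ) : ∀ (a : ℕ), (∀ x ∈ a :: t, 1 ≤ x) →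
    (List.replicate (a - 1) false ++ flags t).length + 1 = (a :: t).sum ∧
    ∀ i (h : i < (List.replicate (a - 1) false ++ flags t).length),
      (List.replicate (a - 1) false ++ flags t)[i] = decide (i + 1 ∈ boundarySet (a :: t)) := by
  induction t with
  | nil =>
    intro a ha
    have := ha a (by simp)
    refine ⟨by simp [flags]; omega, ?_⟩
    intro i h
    simp [flags, boundarySet]
  | cons b t ih =>
    intro a ha
    have h1 := ha a (by simp)
    obtain ⟨hl, hg⟩ := ih b (fun x hx => ha x (by simp at hx ⊢; tauto))
    refine ⟨?_, ?_⟩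
    · rw [List.length_append, flags, List.length_cons, List.sum_cons, ← hl, List.length_replicate]
      omega
    · intro i h
      have key : i + 1 ∈ boundarySet (a :: b :: t) ↔ i + 1 = a ∨ ∃ j ∈ boundarySet (b :: t), i + 1 = a + j :=
        bs_cons a b t (i + 1)
      have h0 : ∀ j ∈ boundarySet (b :: t), 1 ≤ j := by
        intro j hj
        cases t with
        | nil => simp [boundarySet] at hj
        | cons b' t =>
          rw [bs_cons] at hj
          have := ha b (by simp)
          rcases hj with rfl | ⟨_, _, rfl⟩ <;> omega
      rcases lt_trichotomy (i + 1) a with hi | hi | hi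
      · rw [List.getElem_append_left (by simp; omega), List.getElem_replicate]
        symm
        rw [decide_eq_false_iff_not, key]
        rintro (hxy | ⟨j, hj, hxy⟩) <;> omega
      · rw [List.getElem_append_right (by simp; omega)]
        have : i - (List.replicate (a - 1) false).length = 0 := by simp; omega
        simp only [this, flags, List.getElem_cons_zero]
        symm
        rw [decide_eq_true_iff, key]
        exact Or.inl hi
      · rw [List.getElem_append_right (by simp; omega)]
        have e : i - (List.replicate (a - 1) false).length = (i - a) + 1 := by simp; omega
        simp only [e, flags, List.getElem_cons_succ]
        rw [hg]
        congr 1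
        rw [eq_iff_iff, key]
        constructor
        · intro hxy
          exact Or.inr ⟨_, hxy, by omega⟩
        · rintro (hxy | ⟨j, hj, hxy⟩)
          · omega
          · rwa [show i - a + 1 = j by omega]

lemma lhs_eq (a : ℕ) (t : List ℕ) (h : ∀ x ∈ a :: t, 1 ≤ x) :
    zetaIdx (a :: t) (2 :: List.replicate ((a :: t).sum - 1) 1) = (F (a :: t).reverse).toReal := by
  obtain ⟨hl, hg⟩ := flags_ext t a h
  rw [← main a t h]
  unfold zetaIdx
  rw [conv _ _ hl.symm]
  congr 1
  congr 1
  ext n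
  congr 1
  congr 1
  apply List.ext_getElem
  · simp
  · intro i h1 h2
    simp only [List.length_map] at h2
    rw [List.getElem_map, hg i h2, List.getElem_ofFn]
    simp only [Prod.mk.injEq, true_and]
    rw [List.getD_cons_succ, List.getD_replicate]
    omega

lemma zp_sum (L : List (List ℕ)) :
    zetaPlusLin ((L.map fun c => Finsupp.single c (1 : ℚ)).sum) =
      (L.map fun c => MZV (mplus c)).sum := by
  have hadd : ∀ x y, zetaPlusLin (x + y) = zetaPlusLin x + zetaPlusLin y := by
    intro x y
    unfold zetaPlusLin
    rw [Finsupp.sum_add_index']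
    · simp
    · intro a b c; push_cast; ring
  induction L with
  | nil => simp [zetaPlusLin]
  | cons c L ih =>
    simp only [List.map_cons, List.sum_cons, hadd, ih]
    congr 1
    simp [zetaPlusLin, Finsupp.sum_single_index]

lemma splits_mem (l : List ℕ) : ∀ c ∈ splits l, c.flatten = l ∧ ∀ b ∈ c, b ≠ [] := by
  induction l with
  | nil => simp [splits]
  | cons a t ih =>
    intro c hc
    simp only [splits, List.mem_append, List.mem_map, List.mem_filterMap] at hc
    rcases hc with ⟨d, hd, rfl⟩ | ⟨d, hd, h⟩
    · obtain ⟨h1, h2⟩ := ih d hd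
      refine ⟨by simp [h1], ?_⟩
      intro b hb
      rcases List.mem_cons.1 hb with rfl | hb
      · simp
      · exact h2 b hb
    · obtain ⟨h1, h2⟩ := ih d hd
      cases d with
      | nil => simp at h
      | cons b r =>
        simp at h
        subst h
        refine ⟨by simpa using h1, ?_⟩
        intro x hx
        rcases List.mem_cons.1 hx with rfl | hx
        · simp
        · exact h2 x (by simp [hx])

lemma splits_pos (l : List ℕ) (hl : ∀ x ∈ l, 1 ≤ x) (c : List (List ℕ)) (hc : c ∈ splits l) :
    ∀ x ∈ c.map List.sum, 1 ≤ x := by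
  obtain ⟨h1, h2⟩ := splits_mem l c hc
  intro x hx
  obtain ⟨b, hb, rfl⟩ := List.mem_map.1 hx
  obtain ⟨y, hy⟩ := List.exists_mem_of_ne_nil b (h2 b hb)
  have : y ∈ l := by rw [← h1]; exact List.mem_flatten.2 ⟨b, hb, hy⟩
  exact (hl y this).trans (List.single_le_sum (by simp) y hy)

lemma toReal_sum {ι : Type} (L : List ι) (g : ι → ℝ≥0∞) (h : ∀ i ∈ L, g i ≠ ⊤) :
    ((L.map g).sum ≠ ⊤) ∧ (L.map g).sum.toReal = (L.map fun i => (g i).toReal).sum := by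
  induction L with
  | nil => simp
  | cons i L ih =>
    obtain ⟨h1, h2⟩ := ih (fun j hj => h j (by simp [hj]))
    have hi := h i (by simp)
    simp only [List.map_cons, List.sum_cons]
    exact ⟨ENNReal.add_ne_top.2 ⟨hi, h1⟩, by rw [ENNReal.toReal_add hi h1, h2]⟩

lemma rhs_eq (l : List ℕ) (hne : l ≠ []) (hl : ∀ x ∈ l, 1 ≤ x) :
    zetaPlusLin (dmap l) = (F l).toReal := by
  obtain ⟨a, t, rfl⟩ := List.exists_cons_of_ne_nil hne
  have hd : dmap (a :: t) = (((splits (a :: t)).map fun c => c.map List.sum).map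
      fun c => Finsupp.single c (1 : ℚ)).sum := by
    rw [dmap, List.map_map]; rfl
  rw [hd, zp_sum, List.map_map, F, ← coarsen t a (fun n => w n 1)]
  have key : ∀ c ∈ splits (a :: t), G (fun n => w n 1) (c.map List.sum) ≠ ⊤ ∧
      MZV (mplus (c.map List.sum)) = (G (fun n => w n 1) (c.map List.sum)).toReal := by
    intro c hc
    have h1 := splits_pos _ hl c hc
    have h2 := splits_ne _ _ c hc
    obtain ⟨b, r, rfl⟩ := List.exists_cons_of_ne_nil h2
    exact ⟨finite _ _ h1, MZV_eq _ _⟩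
  rw [(toReal_sum _ _ (fun c hc => (key c hc).1)).2]
  congr 1
  apply List.map_congr_left
  intro c hc
  exact (key c hc).2

end DT

/-- For every multi-index `α`, `ζ_α(2,1,…,1) = ζ⁺(d(α^τ))`, the
argument on the left having `|α|` entries. -/
theorem zetaIdx_two_ones_eq_dtau (α : List ℕ) (hα : MIdx α) :
    zetaIdx α (2 :: List.replicate (α.sum - 1) 1) = zetaPlusLin (dmap α.reverse) := by
  obtain ⟨hne, hpos⟩ := hα
  rw [DT.rhs_eq _ (by simpa using hne) (by simpa using hpos)]
  obtain ⟨a, t, rfl⟩ := List.exists_cons_of_ne_nil hne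
  exact DT.lhs_eq a t hpos
end

section
/- For every multi-index α of weight m, ζ_α(2,1,…,1), where the argument has m entries, equals ζ^+( u(α*) ). -/
open scoped BigOperators

/-! ### Finsupp side -/

theorem zetaPlusLin_umap (L : List ℕ) :
    zetaPlusLin (umap L) = ((refts L).map fun β => MZV (mplus β)).sum := by
  unfold umap
  induction refts L with
  | nil => simp [zetaPlusLin]
  | cons b l ih =>
    simp only [List.map_cons, List.sum_cons]
    rw [← ih]
    unfold zetaPlusLin
    rw [Finsupp.sum_add_index' (by simp) (by intros; push_cast; ring)]
    rw [Finsupp.sum_single_index (by simp)]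
    simp

/-! ### Words, dual index and refinements -/

/-- The composition attached to a word: `true` merges. -/
def wcomp : List Bool → List ℕ
  | [] => [1]
  | true :: w => mplus (wcomp w)
  | false :: w => 1 :: wcomp w

/-- The refinements attached to a word. -/
def wref : List Bool → List (List ℕ)
  | [] => [[1]]
  | true :: w => (wref w).map (fun β => 1 :: β) ++ (wref w).map mplus
  | false :: w => (wref w).map (fun β => 1 :: β)

theorem wcomp_form (w : List Bool) : ∃ a t, wcomp w = (a + 1) :: t := by
  induction w with
  | nil => exact ⟨0, [], rfl⟩
  | cons b w ih =>
    obtain ⟨a, t, h⟩ := ih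
    cases b
    · exact ⟨0, wcomp w, rfl⟩
    · exact ⟨a + 1, t, by simp [wcomp, h, mplus]⟩

theorem wref_form (w : List Bool) : ∀ β ∈ wref w, ∃ a t, β = (a + 1) :: t ∧ (∀ b ∈ t, 1 ≤ b) := by
  induction w with
  | nil => intro β h; simp [wref] at h; exact ⟨0, [], by simp [h]⟩
  | cons b w ih =>
    have key : ∀ γ ∈ wref w, ∃ a t, 1 :: γ = (a + 1) :: t ∧ (∀ b ∈ t, 1 ≤ b) := by
      intro γ hγ
      obtain ⟨a, t, h, ht⟩ := ih γ hγ
      refine ⟨0, γ, rfl, ?_⟩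
      subst h
      simpa using ht
    intro β h
    cases b
    · simp only [wref, List.mem_map] at h
      obtain ⟨γ, hγ, rfl⟩ := h
      exact key γ hγ
    · simp only [wref, List.mem_append, List.mem_map] at h
      rcases h with ⟨γ, hγ, rfl⟩ | ⟨γ, hγ, rfl⟩
      · exact key γ hγ
      · obtain ⟨a, t, h, ht⟩ := ih γ hγ
        exact ⟨a + 1, t, by simp [h, mplus], ht⟩

theorem comps_succ_succ (n : ℕ) :
    comps (n + 2) = (comps (n + 1)).map (fun c => 1 :: c) ++ (comps (n + 1)).map mplus := by
  rw [comps, List.range_succ_eq_map, List.flatMap_cons]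
  congr 1
  rw [comps, List.map_flatMap, List.flatMap_map]
  congr 1
  funext j
  simp [mplus, Function.comp_def]

theorem comps_ne_nil (n : ℕ) : ∀ c ∈ comps (n + 1), c ≠ [] := by
  intro c hc
  rw [comps] at hc
  simp only [List.mem_flatMap, List.mem_map] at hc
  obtain ⟨j, _, d, _, rfl⟩ := hc
  simp

theorem refts_wcomp (w : List Bool) : refts (wcomp w) = wref w := by
  induction w with
  | nil => simp [wcomp, wref, refts, comps]
  | cons b w ih =>
    cases b
    · simp [wcomp, wref, refts, comps, ih]
    · obtain ⟨a, t, h⟩ := wcomp_form w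
      simp only [wcomp, wref, ← ih]
      simp only [h, mplus, refts]
      rw [comps_succ_succ, List.flatMap_append]
      congr 1
      · rw [List.map_flatMap, List.flatMap_map]
        simp [Function.comp_def]
      · rw [List.map_flatMap, List.flatMap_map]
        apply List.flatMap_congr
        intro c hc
        have := comps_ne_nil a c hc
        cases c with
        | nil => exact absurd rfl this
        | cons x c => simp [mplus, Function.comp_def]

/-- The word of `S` on the positions `q, …, q + n - 1`. -/
def wordOf (S : ℕ → Bool) (q n : ℕ) : List Bool := (List.range' q n).map S

theorem diffAux_word (S : ℕ → Bool) (n : ℕ) : ∀ q p, p ≤ q →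
    diffAux p (((List.range' (q + 1) n).filter (fun i => !S i)) ++ [q + 1 + n]) =
      (match wcomp (wordOf S (q + 1) n) with
        | [] => []
        | a :: t => (a + (q - p)) :: t) := by
  induction n with
  | zero =>
    intro q p h
    simp [diffAux, wordOf, wcomp]
    omega
  | succ n ih =>
    intro q p h
    have e : q + 1 + (n + 1) = q + 1 + 1 + n := by ring
    obtain ⟨a, t, hw⟩ := wcomp_form (wordOf S (q + 1 + 1) n)
    have hword : wordOf S (q + 1) (n + 1) = S (q + 1) :: wordOf S (q + 1 + 1) n := by
      simp [wordOf, List.range'_succ]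
    rw [hword, List.range'_succ, e]
    cases hS : S (q + 1)
    · have := ih (q + 1) (q + 1) le_rfl
      simp [hS, diffAux, wcomp, this, hw]
      omega
    · have := ih (q + 1) p (by omega)
      simp [hS, wcomp, this, hw, mplus]
      omega

theorem dualIdx_word (α : List ℕ) (M : ℕ) (hM : α.sum = M + 1) :
    dualIdx α = wcomp (wordOf (fun i => decide (i ∈ boundarySet α)) 1 M) := by
  have h := diffAux_word (fun i => decide (i ∈ boundarySet α)) M 0 0 le_rfl
  obtain ⟨a, t, hw⟩ := wcomp_form (wordOf (fun i => decide (i ∈ boundarySet α)) 1 M)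
  simp only [zero_add, hw, Nat.sub_self, add_zero] at h
  rw [hw, ← h, dualIdx]
  congr 1
  symm
  apply List.Perm.eq_of_pairwise (le := (· ≤ ·))
  · intro a b _ _ h1 h2; exact le_antisymm h1 h2
  · rw [List.pairwise_append]
    refine ⟨?_, by simp, ?_⟩
    · exact (List.pairwise_le_range' (s := 1) (n := M)).filter _
    · intro x hx y hy
      simp at hx hy
      omega
  · exact Finset.pairwise_sort _ _
  · rw [List.perm_ext_iff_of_nodup]
    · intro x
      simp [hM]
      constructor
      · rintro (h | h)
        · right; exact ⟨by omega, h.2⟩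
        · left; omega
      · rintro (h | h)
        · right; omega
        · left; exact ⟨by omega, h.2⟩
    · rw [List.nodup_append]
      refine ⟨(List.nodup_range' (s := 1) (n := M)).filter _, by simp, ?_⟩
      intro x hx y hy
      simp at hx hy
      omega
    · exact Finset.sort_nodup _ _

/-! ### Nested sums in `ENNReal` -/

open scoped ENNReal

/-- `1/n`. -/
noncomputable def xinv (n : ℕ) : ℝ≥0∞ := (n : ℝ≥0∞)⁻¹

/-- Iterated inner sums. -/
noncomputable def usum : List (Bool × ℕ) → ℕ → ℝ≥0∞
  | [], _ => 1
  | (b, e) :: w, n => ∑ k ∈ Finset.Icc 1 (if b then n else n - 1), xinv k ^ e * usum w k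

noncomputable def gword (w : List Bool) (n : ℕ) : ℝ≥0∞ := usum (w.map fun b => (b, 1)) n

noncomputable def hword (t : List ℕ) (n : ℕ) : ℝ≥0∞ := usum (t.map fun e => (false, e)) n

noncomputable def tword (β : List ℕ) (n : ℕ) : ℝ≥0∞ := xinv n ^ (β.headD 0) * hword β.tail n

theorem sum_list_comm (l : List (List ℕ)) (s : Finset ℕ) (f : List ℕ → ℕ → ℝ≥0∞) :
    ∑ k ∈ s, (l.map fun β => f β k).sum = (l.map fun β => ∑ k ∈ s, f β k).sum := by
  induction l with
  | nil => simp
  | cons b l ih => simp [Finset.sum_add_distrib, ih]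

theorem gword_strict (w : List Bool) (ih : ∀ n, 1 ≤ n → xinv n * gword w n = ((wref w).map fun β => tword β n).sum) (n : ℕ) :
    gword (false :: w) n = ((wref w).map fun β => hword β n).sum := by
  have : gword (false :: w) n = ∑ k ∈ Finset.Icc 1 (n - 1), xinv k * gword w k := by
    simp [gword, usum]
  rw [this, Finset.sum_congr rfl (fun k hk => ih k (Finset.mem_Icc.1 hk).1), sum_list_comm]
  congr 1
  apply List.map_congr_left
  intro β hβ
  obtain ⟨a, t, rfl, -⟩ := wref_form w β hβ
  simp [hword, usum, tword]

theorem gword_main (w : List Bool) : ∀ n, 1 ≤ n →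
    xinv n * gword w n = ((wref w).map fun β => tword β n).sum := by
  induction w with
  | nil => intro n _; simp [gword, usum, wref, tword, hword]
  | cons b w ih =>
    intro n hn
    have hs := gword_strict w ih n
    have h1 : xinv n * gword (false :: w) n
        = (((wref w).map (fun β => 1 :: β)).map fun β => tword β n).sum := by
      rw [hs, ← List.sum_map_mul_left]
      simp [tword, Function.comp_def]
    cases b
    · exact h1
    · have h2 : gword (true :: w) n = gword (false :: w) n + xinv n * gword w n := by
        obtain ⟨m, rfl⟩ : ∃ m, n = m + 1 := ⟨n - 1, by omega⟩
        simp [gword, usum, Finset.sum_Icc_succ_top]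
      rw [h2, mul_add, h1, wref, List.map_append, List.sum_append, ih n hn]
      congr 1
      rw [← List.sum_map_mul_left, List.map_map]
      congr 1
      apply List.map_congr_left
      intro β hβ
      obtain ⟨a, t, rfl, -⟩ := wref_form w β hβ
      simp [tword, mplus]
      ring

/-! ### Unfolding the multiple series -/

/-- relation between consecutive variables -/
def crel (b : Bool) (a c : ℕ) : Prop := if b then c ≤ a else c < a

def chainP (m : ℕ) (S : ℕ → Bool) (v : Fin m → ℕ) : Prop :=
  (∀ j, 0 < v j) ∧ (∀ j k : Fin m, (k : ℕ) = (j : ℕ) + 1 → crel (S k) (v j) (v k))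

open Classical in
noncomputable def cterm (m : ℕ) (S : ℕ → Bool) (e : ℕ → ℕ) (v : Fin m → ℕ) : ℝ≥0∞ :=
  if chainP m S v then ∏ j : Fin m, xinv (v j) ^ e j else 0

def ulist (m : ℕ) (S : ℕ → Bool) (e : ℕ → ℕ) : List (Bool × ℕ) :=
  (List.range m).map fun i => (S i, e i)

theorem ulist_succ (m : ℕ) (S : ℕ → Bool) (e : ℕ → ℕ) :
    ulist (m + 1) S e = (S 0, e 0) :: ulist m (fun i => S (i + 1)) (fun i => e (i + 1)) := by
  simp [ulist, List.range_succ_eq_map, Function.comp_def]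

theorem chainP_cons (m : ℕ) (S : ℕ → Bool) (k : ℕ) (v : Fin m → ℕ) :
    chainP (m + 1) S (Fin.cons k v) ↔
      0 < k ∧ ((∀ h : 0 < m, crel (S 1) k (v ⟨0, h⟩)) ∧ chainP m (fun i => S (i + 1)) v) := by
  unfold chainP
  constructor
  · rintro ⟨h1, h2⟩
    refine ⟨by simpa using h1 0, ?_, ?_, ?_⟩
    · intro h
      have := h2 0 (Fin.succ ⟨0, h⟩) (by simp)
      rw [Fin.cons_zero, Fin.cons_succ] at this
      exact this
    · intro j; simpa using h1 j.succ
    · intro j k hjk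
      simpa using h2 j.succ k.succ (by simp [hjk])
  · rintro ⟨h0, h1, h2, h3⟩
    refine ⟨?_, ?_⟩
    · intro j
      refine Fin.cases (by simpa using h0) (fun j => by simpa using h2 j) j
    · intro j k
      refine Fin.cases ?_ (fun k => ?_) k
      · intro h; simp at h
      · refine Fin.cases ?_ (fun j => ?_) j
        · intro h
          simp at h
          have hk : k = ⟨0, by have := k.2; omega⟩ := Fin.ext h
          have := h1 (by have := k.2; omega)
          rw [hk, Fin.cons_zero, Fin.cons_succ]
          exact this
        · intro h
          simpa using h3 j k (by simpa using h)

theorem tsum_cons (m : ℕ) (f : (Fin (m + 1) → ℕ) → ℝ≥0∞) :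
    ∑' v, f v = ∑' k, ∑' v : Fin m → ℕ, f (Fin.cons k v) := by
  rw [← (Fin.consEquiv (fun _ : Fin (m + 1) => ℕ)).tsum_eq f]
  rw [ENNReal.tsum_prod']
  rfl

open Classical in
theorem cterm_cons (m : ℕ) (S : ℕ → Bool) (e : ℕ → ℕ) (k : ℕ) (v : Fin m → ℕ) :
    cterm (m + 1) S e (Fin.cons k v) = if 0 < k then xinv k ^ e 0 *
      (if (∀ h : 0 < m, crel (S 1) k (v ⟨0, h⟩)) then
        cterm m (fun i => S (i + 1)) (fun i => e (i + 1)) v else 0) else 0 := by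
  unfold cterm
  simp only [chainP_cons, Fin.prod_univ_succ, Fin.cons_zero, Fin.cons_succ, Fin.val_zero,
    Fin.val_succ]
  by_cases h1 : 0 < k <;> by_cases h2 : (∀ h : 0 < m, crel (S 1) k (v ⟨0, h⟩)) <;>
    by_cases h3 : chainP m (fun i => S (i + 1)) v
  all_goals simp only [h1, h2, h3, and_self, and_true, and_false, true_and, false_and, if_true,
    if_false, mul_zero, implies_true]

open Classical in
theorem inner_chain_sum (m : ℕ) : ∀ (S : ℕ → Bool) (e : ℕ → ℕ) (n : ℕ),
    ∑' v : Fin m → ℕ, (if (∀ h : 0 < m, crel (S 0) n (v ⟨0, h⟩)) then cterm m S e v else 0)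
      = usum (ulist m S e) n := by
  induction m with
  | zero =>
    intro S e n
    simp [ulist, usum, cterm, chainP]
  | succ m ih =>
    intro S e n
    rw [tsum_cons, ulist_succ, usum]
    rw [tsum_eq_sum (s := Finset.Icc 1 (if S 0 then n else n - 1))]
    · apply Finset.sum_congr rfl
      intro k hk
      rw [Finset.mem_Icc] at hk
      rw [← ih, ← ENNReal.tsum_mul_left]
      congr 1
      funext v
      have hr : crel (S 0) n k := by
        unfold crel; cases hS : S 0 <;> simp [hS] at hk ⊢ <;> omega
      have hk0 : 0 < k := hk.1
      rw [cterm_cons]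
      simp [hr, hk0]
    · intro k hk
      rw [Finset.mem_Icc] at hk
      rw [ENNReal.tsum_eq_zero]
      intro v
      rw [cterm_cons]
      by_cases hk0 : 0 < k
      · have hr : ¬ crel (S 0) n k := by
          unfold crel; cases hS : S 0 <;> simp [hS] at hk ⊢ <;> omega
        simp [hr]
      · simp [hk0]

theorem outer_sum (m : ℕ) (S : ℕ → Bool) (e : ℕ → ℕ) :
    ∑' v : Fin (m + 1) → ℕ, cterm (m + 1) S e v =
      ∑' k : ℕ, if 0 < k then xinv k ^ e 0 *
        usum (ulist m (fun i => S (i + 1)) (fun i => e (i + 1))) k else 0 := by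
  classical
  rw [tsum_cons]
  congr 1
  funext k
  simp only [cterm_cons]
  split_ifs
  · rw [ENNReal.tsum_mul_left, ← inner_chain_sum]
  · simp

theorem zetaIdx_eq_s11 (α μ : List ℕ) :
    zetaIdx α μ = (∑' v : Fin α.sum → ℕ, cterm α.sum (fun i => decide (i ∈ boundarySet α))
      (fun j => μ.getD j 1) v).toReal := by
  classical
  have hfin : ∀ v : Fin α.sum → ℕ, cterm α.sum (fun i => decide (i ∈ boundarySet α))
      (fun j => μ.getD j 1) v ≠ ∞ := by
    intro v
    unfold cterm
    split_ifs with h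
    · apply ENNReal.prod_ne_top
      intro j _
      apply ENNReal.pow_ne_top
      have := h.1 j
      simp [xinv]
      omega
    · simp
  rw [ENNReal.tsum_toReal_eq hfin]
  unfold zetaIdx
  congr 1
  funext v
  unfold cterm chainP crel
  simp only [decide_eq_true_eq]
  split_ifs <;> simp [ENNReal.toReal_prod, xinv]

/-! ### Convergence -/

theorem usum_le (w : List (Bool × ℕ)) (hw : ∀ p ∈ w, 1 ≤ p.2) (n : ℕ) :
    usum w n ≤ (∑ k ∈ Finset.Icc 1 n, xinv k) ^ w.length := by
  induction w generalizing n with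
  | nil => simp [usum]
  | cons p w ih =>
    obtain ⟨b, e⟩ := p
    rw [usum, List.length_cons, pow_succ']
    calc _ ≤ ∑ k ∈ Finset.Icc 1 n, xinv k ^ e * usum w k := by
          apply Finset.sum_le_sum_of_subset
          apply Finset.Icc_subset_Icc_right
          split_ifs <;> omega
      _ ≤ ∑ k ∈ Finset.Icc 1 n, xinv k * (∑ k ∈ Finset.Icc 1 n, xinv k) ^ w.length := by
          apply Finset.sum_le_sum
          intro k hk
          rw [Finset.mem_Icc] at hk
          have hx : xinv k ≤ 1 := by
            simp only [xinv]
            rw [ENNReal.inv_le_one]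
            exact_mod_cast hk.1
          have he : 1 ≤ e := hw (b, e) (by simp)
          gcongr
          · calc xinv k ^ e ≤ xinv k ^ 1 := pow_le_pow_right_of_le_one' hx he
              _ = _ := pow_one _
          · refine (ih (fun p hp => hw p (by simp [hp])) k).trans ?_
            gcongr
            exact hk.2
      _ = _ := by rw [Finset.sum_mul]

theorem real_summable (p : ℕ) :
    Summable (fun n : ℕ => (1 / (n : ℝ)) ^ 2 * (1 + Real.log n) ^ p) := by
  have h : (fun x : ℝ => (1 + Real.log x)) =O[Filter.atTop] Real.log := by
    apply Asymptotics.IsBigO.add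
    · exact (Real.isLittleO_const_log_atTop (c := 1)).isBigO
    · exact Asymptotics.isBigO_refl _ _
  have h2 : (fun x : ℝ => (Real.log x) ^ p) =O[Filter.atTop] fun x : ℝ => x ^ ((1 : ℝ) / 2) := by
    have := (isLittleO_log_rpow_rpow_atTop (p : ℝ) (s := 1 / 2) (by norm_num)).isBigO
    simpa using this
  have h3 : (fun n : ℕ => (1 + Real.log (n : ℝ)) ^ p) =O[Filter.atTop]
      fun n : ℕ => (n : ℝ) ^ ((1 : ℝ) / 2) :=
    ((h.pow p).trans h2).comp_tendsto tendsto_natCast_atTop_atTop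
  have h4 := (Asymptotics.isBigO_refl (fun n : ℕ => (1 / (n : ℝ)) ^ 2) Filter.atTop).mul h3
  have h5 : Summable (fun n : ℕ => (n : ℝ) ^ (-(3 : ℝ) / 2)) :=
    Real.summable_nat_rpow.2 (by norm_num)
  refine summable_of_isBigO_nat h5 (h4.trans ?_)
  apply Asymptotics.IsBigO.of_bound 1
  filter_upwards [Filter.eventually_gt_atTop 0] with n hn
  have hn' : (0 : ℝ) < n := by exact_mod_cast hn
  have : (1 / (n : ℝ)) ^ 2 * (n : ℝ) ^ ((1 : ℝ) / 2) = (n : ℝ) ^ (-(3 : ℝ) / 2) := by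
    have e : (1 / (n : ℝ)) ^ 2 = (n : ℝ) ^ (-(2 : ℝ)) := by
      rw [Real.rpow_neg hn'.le]; norm_cast; simp
    rw [e, ← Real.rpow_add hn']
    norm_num
  rw [this, one_mul]

theorem tsum_ne_top (w : List (Bool × ℕ)) (hw : ∀ p ∈ w, 1 ≤ p.2) (a : ℕ) :
    (∑' k : ℕ, if 0 < k then xinv k ^ (a + 2) * usum w k else 0) ≠ ∞ := by
  refine ne_top_of_le_ne_top (real_summable w.length).tsum_ofReal_ne_top ?_
  refine ENNReal.tsum_le_tsum fun k => ?_
  split_ifs with hk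
  · have hk' : (0 : ℝ) < k := by exact_mod_cast hk
    have hxe : ∀ i : ℕ, 0 < i → xinv i = ENNReal.ofReal (1 / (i : ℝ)) := by
      intro i hi
      have hi' : (0 : ℝ) < i := by exact_mod_cast hi
      rw [one_div, ENNReal.ofReal_inv_of_pos hi', ENNReal.ofReal_natCast, xinv]
    have hlog : 0 ≤ Real.log k := Real.log_natCast_nonneg k
    have hx : xinv k ≤ 1 := by
      simp only [xinv]
      rw [ENNReal.inv_le_one]
      exact_mod_cast hk
    rw [ENNReal.ofReal_mul (by positivity), ENNReal.ofReal_pow (by positivity),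
      ENNReal.ofReal_pow (by positivity), ← hxe k hk]
    refine mul_le_mul' ?_ ?_
    · exact pow_le_pow_right_of_le_one' hx (by omega)
    · refine (usum_le w hw k).trans ?_
      gcongr
      rw [Finset.sum_congr rfl (fun i hi => hxe i (Finset.mem_Icc.1 hi).1),
        ← ENNReal.ofReal_sum_of_nonneg (fun i _ => by positivity)]
      apply ENNReal.ofReal_le_ofReal
      have := harmonic_le_one_add_log k
      rw [harmonic_eq_sum_Icc] at this
      push_cast at this
      simpa using this
  · simp

theorem mzv_eq (a : ℕ) (t : List ℕ) :
    MZV ((a + 1) :: t) = (∑' k : ℕ, if 0 < k then tword ((a + 1) :: t) k else 0).toReal := by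
  rw [MZV, zetaIdx_eq_s11]
  have hb : boundarySet [((a + 1) :: t).length] = ∅ := by simp [boundarySet]
  rw [hb]
  have hs : [((a + 1) :: t).length].sum = t.length + 1 := by simp
  rw [hs, outer_sum]
  have hl : ulist t.length (fun i => decide (i + 1 ∈ (∅ : Finset ℕ)))
      (fun i => ((a + 1) :: t).getD (i + 1) 1) = t.map fun e => (false, e) := by
    apply List.ext_getElem
    · simp [ulist]
    · intro i h1 h2
      simp [ulist] at h1
      simp [ulist, h1]
  rw [hl]
  simp [tword, hword]

theorem list_toReal_sum (l : List (List ℕ))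
    (hform : ∀ β ∈ l, ∃ a t, β = (a + 1) :: t ∧ (∀ b ∈ t, 1 ≤ b)) :
    (∑' k : ℕ, (l.map fun β => if 0 < k then tword (mplus β) k else 0).sum) ≠ ∞ ∧
    (∑' k : ℕ, (l.map fun β => if 0 < k then tword (mplus β) k else 0).sum).toReal =
      (l.map fun β => MZV (mplus β)).sum := by
  induction l with
  | nil => simp
  | cons β l ih =>
    obtain ⟨h1, h2⟩ := ih (fun β hβ => hform β (by simp [hβ]))
    simp only [List.map_cons, List.sum_cons]
    rw [ENNReal.tsum_add, ← h2]
    obtain ⟨a, t, rfl, ht⟩ := hform β (by simp)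
    have hf : (∑' k : ℕ, if 0 < k then tword (mplus ((a + 1) :: t)) k else 0) ≠ ∞ := by
      have := tsum_ne_top (t.map fun e => (false, e)) (by simpa using ht) a
      simpa [tword, mplus, hword] using this
    refine ⟨ENNReal.add_ne_top.2 ⟨hf, h1⟩, ?_⟩
    rw [ENNReal.toReal_add hf h1]
    congr 1
    exact (mzv_eq (a + 1) t).symm

/-- For every multi-index `α` of weight `m`,
`ζ_α(2,1,…,1) = ζ⁺(u(α*))`, the argument on the left having `m` entries. -/
theorem zetaIdx_two_ones_eq_udual (α : List ℕ) (hα : MIdx α) :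
    zetaIdx α (2 :: List.replicate (α.sum - 1) 1) = zetaPlusLin (umap (dualIdx α)) := by
  have hsum : ∃ M, α.sum = M + 1 := by
    obtain ⟨hne, hpos⟩ := hα
    cases α with
    | nil => exact absurd rfl hne
    | cons a t =>
      have := hpos a (by simp)
      exact ⟨a + t.sum - 1, by simp; omega⟩
  obtain ⟨M, hM⟩ := hsum
  rw [zetaPlusLin_umap, dualIdx_word α M hM, refts_wcomp, zetaIdx_eq_s11, hM, outer_sum]
  set w := wordOf (fun i => decide (i ∈ boundarySet α)) 1 M with hw
  have hl : ulist M (fun i => decide (i + 1 ∈ boundarySet α))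
      (fun i => (2 :: List.replicate (M + 1 - 1) 1).getD (i + 1) 1) = w.map fun b => (b, 1) := by
    apply List.ext_getElem
    · simp [ulist, hw, wordOf]
    · intro i h1 h2
      simp [ulist] at h1
      simp [ulist, hw, wordOf, add_comm]
  rw [hl]
  have key : ∀ k : ℕ, (if 0 < k then xinv k ^ ((2 :: List.replicate (M + 1 - 1) 1).getD 0 1) *
      usum (w.map fun b => (b, 1)) k else 0) =
      ((wref w).map fun β => if 0 < k then tword (mplus β) k else 0).sum := by
    intro k
    split_ifs with hk
    · have h := gword_main w k hk
      have : xinv k ^ ((2 :: List.replicate (M + 1 - 1) 1).getD 0 1) *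
          usum (w.map fun b => (b, 1)) k = xinv k * (xinv k * gword w k) := by
        simp [gword]; ring
      rw [this, h, ← List.sum_map_mul_left]
      congr 1
      apply List.map_congr_left
      intro β hβ
      obtain ⟨a, t, rfl, -⟩ := wref_form w β hβ
      simp [tword, mplus]
      ring
    · simp
  simp only [key]
  exact (list_toReal_sum (wref w) (wref_form w)).2
end
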